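/- Fix an integer d ≥ 2 and a real 0 < c < c_d^*. Then E[dim ker ∂_d(Y_d(n, c/n))] = o(n^d); equivalently, E[dim ker ∂_d(Y_d(n,c/n))] / C(n,d) → 0 as n → ∞. -/

import Mathlib

open Finset Filter
open scoped Classical

noncomputable section

/-- The set of all possible `d`-faces: `(d+1)`-element subsets of `[n]`. -/
def allFaces (n d : ℕ) : Finset (Finset (Fin n)) :=
  Finset.univ.filter (fun σ => σ.card = d + 1)

/-- Probability of the event `E` under `Y_d(n,p)`. -/
def probY (n d : ℕ) (p : ℝ) (E : Finset (Finset (Fin n)) → Prop) : ℝ :=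
  ∑ F ∈ (allFaces n d).powerset,
    if E F then p ^ F.card * (1 - p) ^ ((allFaces n d).card - F.card) else 0

/-- Expectation of `X` under `Y_d(n,p)`. -/
def expectY (n d : ℕ) (p : ℝ) (X : Finset (Finset (Fin n)) → ℝ) : ℝ :=
  ∑ F ∈ (allFaces n d).powerset,
    p ^ F.card * (1 - p) ^ ((allFaces n d).card - F.card) * X F

/-- Coefficient of the `d`-face `τ` in the boundary of `σ`. -/
def bdCoeff {n : ℕ} (τ σ : Finset (Fin n)) : ℝ :=
  if τ ⊆ σ ∧ τ.card + 1 = σ.card then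
    ∑ v ∈ σ \ τ, (-1 : ℝ) ^ (σ.filter (fun w => w < v)).card
  else 0

/-- The boundary operator `∂_d(F) : ℝ^F → ℝ^{(d-1)-faces}`. -/
def boundaryMap (n : ℕ) (F : Finset (Finset (Fin n))) :
    (↥F → ℝ) →ₗ[ℝ] (Finset (Fin n) → ℝ) where
  toFun x := fun τ => ∑ σ ∈ F.attach, x σ * bdCoeff τ σ.1
  map_add' x y := by
    funext τ
    simp [add_mul, Finset.sum_add_distrib]
  map_smul' c x := by
    funext τ
    simp [Finset.mul_sum, mul_assoc]

/-- Dimension of the kernel of `∂_d(F)`, i.e. `dim H_d`. -/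
def dimKer (n : ℕ) (F : Finset (Finset (Fin n))) : ℕ :=
  Module.finrank ℝ (LinearMap.ker (boundaryMap n F))

/-- The real shadow of `F`. -/
def shadowR (n d : ℕ) (F : Finset (Finset (Fin n))) : Finset (Finset (Fin n)) :=
  (allFaces n d).filter (fun σ => σ ∉ F ∧ dimKer n F < dimKer n (insert σ F))

/-- The `(d+2)`-subsets all of whose `(d+1)`-subsets are faces of `F`. -/
def simplexBoundaries (n d : ℕ) (F : Finset (Finset (Fin n))) : Finset (Finset (Fin n)) :=
  Finset.univ.filter (fun τ => τ.card = d + 2 ∧ ∀ s ∈ τ.powerset, s.card = d + 1 → s ∈ F)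

/-- The boundary cycle of the `(d+2)`-subset `τ`, as a vector in `ℝ^F`. -/
def simplexCycle (n : ℕ) (F : Finset (Finset (Fin n))) (τ : Finset (Fin n)) : ↥F → ℝ :=
  fun σ => bdCoeff σ.1 τ


noncomputable section

/-- the function whose root is `t_d^*` -/
def hfun (d : ℝ) (t : ℝ) : ℝ := (d + 1) * (1 - t) + (1 + d * t) * Real.log t

lemma hfun_deriv (d t : ℝ) (ht : 0 < t) :
    HasDerivAt (hfun d) (-1 + d * Real.log t + 1 / t) t := by
  have h1 : HasDerivAt (fun t : ℝ => (d + 1) * (1 - t)) ((d + 1) * (0 - 1)) t :=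
    ((hasDerivAt_const t 1).sub (hasDerivAt_id t)).const_mul _
  have h2 : HasDerivAt (fun t : ℝ => 1 + d * t) (0 + d * 1) t :=
    (hasDerivAt_const t 1).add ((hasDerivAt_id t).const_mul d)
  have h3 := h2.mul (Real.hasDerivAt_log ht.ne')
  have h4 := h1.add h3
  refine h4.congr_deriv ?_
  field_simp
  ring

lemma hfun_deriv2 (d t : ℝ) (ht : 0 < t) :
    HasDerivAt (fun t => -1 + d * Real.log t + 1 / t) ((d * t - 1) / t ^ 2) t := by
  have h1 : HasDerivAt (fun t : ℝ => -1 + d * Real.log t) (0 + d * t⁻¹) t :=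
    (hasDerivAt_const t (-1)).add ((Real.hasDerivAt_log ht.ne').const_mul d)
  have h2 := h1.add (hasDerivAt_inv ht.ne')
  have h3 : HasDerivAt (fun t => -1 + d * Real.log t + 1 / t) (0 + d * t⁻¹ + -(t ^ 2)⁻¹) t := by
    simp only [one_div]
    exact h2
  refine h3.congr_deriv ?_
  field_simp
  ring

/-- On `[1/d, 1)` the function is positive. -/
lemma hfun_pos (d : ℝ) (hd : 2 ≤ d) (t : ℝ) (h1 : 1 / d ≤ t) (h2 : t < 1) : 0 < hfun d t := by
  have hd0 : 0 < d := by linarith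
  have hd1 : 0 < 1 / d := by positivity
  -- derivative negative on [1/d,1)
  have hmono : StrictMonoOn (fun t => -1 + d * Real.log t + 1 / t) (Set.Icc (1 / d) 1) := by
    apply strictMonoOn_of_deriv_pos (convex_Icc _ _)
    · intro x hx
      exact (hfun_deriv2 d x (lt_of_lt_of_le hd1 hx.1)).continuousAt.continuousWithinAt
    · intro x hx
      rw [interior_Icc] at hx
      have hx0 : 0 < x := hd1.trans hx.1
      rw [(hfun_deriv2 d x hx0).deriv]
      have : 1 < d * x := by
        have := hx.1
        rw [div_lt_iff₀ hd0] at this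
        linarith
      apply div_pos (by linarith) (by positivity)
  have hanti : StrictAntiOn (hfun d) (Set.Icc (1 / d) 1) := by
    apply strictAntiOn_of_deriv_neg (convex_Icc _ _)
    · intro x hx
      exact (hfun_deriv d x (lt_of_lt_of_le hd1 hx.1)).continuousAt.continuousWithinAt
    · intro x hx
      rw [interior_Icc] at hx
      have hx0 : 0 < x := hd1.trans hx.1
      rw [(hfun_deriv d x hx0).deriv]
      have := hmono ⟨hx.1.le, hx.2.le⟩ ⟨hx.1.le.trans hx.2.le, le_refl 1⟩ hx.2
      simpa using this
  have := hanti ⟨h1, h2.le⟩ ⟨h1.trans h2.le, le_refl 1⟩ h2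
  simpa [hfun] using this

lemma hfun_concave (d : ℝ) (hd : 2 ≤ d) : ConcaveOn ℝ (Set.Ioc 0 (1 / d)) (hfun d) := by
  have hd0 : 0 < d := by linarith
  apply AntitoneOn.concaveOn_of_deriv (convex_Ioc _ _)
  · intro x hx
    exact (hfun_deriv d x hx.1).continuousAt.continuousWithinAt
  · intro x hx
    rw [interior_Ioc] at hx
    exact (hfun_deriv d x hx.1).differentiableAt.differentiableWithinAt
  · rw [interior_Ioc]
    have : AntitoneOn (fun t => -1 + d * Real.log t + 1 / t) (Set.Ioo 0 (1 / d)) := by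
      apply antitoneOn_of_deriv_nonpos (convex_Ioo _ _)
      · intro x hx
        exact (hfun_deriv2 d x hx.1).continuousAt.continuousWithinAt
      · intro x hx
        rw [interior_Ioo] at hx
        exact (hfun_deriv2 d x hx.1).differentiableAt.differentiableWithinAt
      · intro x hx
        rw [interior_Ioo] at hx
        rw [(hfun_deriv2 d x hx.1).deriv]
        have : d * x < 1 := by
          have := hx.2
          rw [lt_div_iff₀ hd0] at this
          linarith
        apply div_nonpos_of_nonpos_of_nonneg (by linarith) (by positivity)
    intro x hx y hy hxy
    rw [(hfun_deriv d x hx.1).deriv, (hfun_deriv d y hy.1).deriv]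
    exact this hx hy hxy

lemma hfun_sign (d : ℝ) (hd : 2 ≤ d) (td : ℝ) (htd : td ∈ Set.Ioo (0 : ℝ) 1)
    (hroot : hfun d td = 0) :
    (∀ t, 0 < t → t ≤ td → hfun d t ≤ 0) ∧ (∀ t, td ≤ t → t < 1 → 0 ≤ hfun d t) := by
  have hd0 : 0 < d := by linarith
  have hd1 : 0 < 1 / d := by positivity
  have hd2 : 1 / d < 1 := by rw [div_lt_one hd0]; linarith
  have hlt : td < 1 / d := by
    by_contra h
    push Not at h
    have := hfun_pos d hd td h htd.2
    linarith
  have hp := hfun_pos d hd (1 / d) le_rfl hd2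
  have hc := hfun_concave d hd
  constructor
  · intro t ht htt
    by_contra hcon
    push Not at hcon
    rcases htt.eq_or_lt with h | h
    · rw [h] at hcon; linarith
    have := hc.min_le_of_mem_Icc (x := t) (y := 1 / d) (z := td)
      ⟨ht, (h.trans hlt).le⟩ ⟨hd1, le_rfl⟩ ⟨h.le, hlt.le⟩
    rw [hroot] at this
    rcases min_le_iff.mp this with h | h <;> linarith
  · intro t ht ht1
    rcases le_total (1 / d) t with h | h
    · exact (hfun_pos d hd t h ht1).le
    have := hc.min_le_of_mem_Icc (x := td) (y := 1 / d) (z := t)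
      ⟨htd.1, hlt.le⟩ ⟨hd1, le_rfl⟩ ⟨ht, h⟩
    rw [hroot, min_eq_left hp.le] at this
    exact this

lemma mpos (u : ℝ) (hu : 0 < u) : 0 < u - 1 + Real.exp (-u) := by
  have := Real.add_one_lt_exp (x := -u) (by linarith)
  linarith

/-- `(d+1) log u - d log (u - 1 + e^{-u})` is minimal at `u* = -log t_d`. -/
lemma u_min (d : ℝ) (hd : 2 ≤ d) (td : ℝ) (htd : td ∈ Set.Ioo (0 : ℝ) 1)
    (hroot : hfun d td = 0) (u : ℝ) (hu : 0 < u) :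
    (d + 1) * Real.log (-Real.log td) - d * Real.log (-Real.log td - 1 + td) ≤
    (d + 1) * Real.log u - d * Real.log (u - 1 + Real.exp (-u)) := by
  obtain ⟨hs1, hs2⟩ := hfun_sign d hd td htd hroot
  set L : ℝ → ℝ := fun u => (d + 1) * Real.log u - d * Real.log (u - 1 + Real.exp (-u)) with hL
  have hderiv : ∀ u : ℝ, 0 < u → HasDerivAt L
      (-(hfun d (Real.exp (-u))) / (u * (u - 1 + Real.exp (-u)))) u := by
    intro u hu
    have hm := mpos u hu
    have h1 : HasDerivAt (fun u : ℝ => u - 1 + Real.exp (-u)) (1 + Real.exp (-u) * (-1)) u := by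
      exact ((hasDerivAt_id u).sub_const 1).add ((hasDerivAt_neg u).exp)
    have h2 := h1.log hm.ne'
    have h3 := ((Real.hasDerivAt_log hu.ne').const_mul (d + 1)).sub (h2.const_mul d)
    refine h3.congr_deriv ?_
    rw [hfun, Real.log_exp]
    field_simp
    ring
  set us := -Real.log td with hus
  have hus0 : 0 < us := by
    have := Real.log_neg htd.1 htd.2
    linarith
  have hexp : Real.exp (-us) = td := by rw [hus, neg_neg, Real.exp_log htd.1]
  have hLs : L us = (d + 1) * Real.log us - d * Real.log (us - 1 + td) := by
    simp only [hL]; rw [hexp]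
  rw [← hLs]
  change L us ≤ L u
  rcases le_total us u with h | h
  · have : MonotoneOn L (Set.Ici us) := by
      apply monotoneOn_of_deriv_nonneg (convex_Ici _)
      · intro x hx
        exact (hderiv x (lt_of_lt_of_le hus0 hx)).continuousAt.continuousWithinAt
      · intro x hx
        rw [interior_Ici] at hx
        exact (hderiv x (hus0.trans hx)).differentiableAt.differentiableWithinAt
      · intro x hx
        rw [interior_Ici] at hx
        have hx0 := hus0.trans hx
        rw [(hderiv x hx0).deriv]
        have := mpos x hx0
        apply div_nonneg _ (by positivity)
        have := hs1 (Real.exp (-x)) (Real.exp_pos _) (by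
          rw [← hexp]; apply Real.exp_le_exp.mpr; have := Set.mem_Ioi.mp hx; linarith)
        linarith
    exact this (Set.mem_Ici.mpr le_rfl) (Set.mem_Ici.mpr h) h
  · have : AntitoneOn L (Set.Ioc 0 us) := by
      apply antitoneOn_of_deriv_nonpos (convex_Ioc _ _)
      · intro x hx
        exact (hderiv x hx.1).continuousAt.continuousWithinAt
      · intro x hx
        rw [interior_Ioc] at hx
        exact (hderiv x hx.1).differentiableAt.differentiableWithinAt
      · intro x hx
        rw [interior_Ioc] at hx
        rw [(hderiv x hx.1).deriv]
        have := mpos x hx.1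
        have hx0 := hx.1
        apply div_nonpos_of_nonpos_of_nonneg _ (by positivity)
        have := hs2 (Real.exp (-x)) (by
          rw [← hexp]; apply Real.exp_le_exp.mpr; linarith [hx.2])
          (by rw [Real.exp_lt_one_iff]; linarith)
        linarith
    exact this ⟨hu, h⟩ ⟨hus0, le_rfl⟩ h

/-- The key inequality `Ψ ≤ Ψ(1)` below the threshold. -/
lemma psi_le (d : ℕ) (hd : 2 ≤ d) (c td : ℝ) (hc0 : 0 < c)
    (htd : td ∈ Set.Ioo (0 : ℝ) 1)
    (hroot : ((d : ℝ) + 1) * (1 - td) + (1 + (d : ℝ) * td) * Real.log td = 0)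
    (hc : c < -Real.log td / (1 - td) ^ d) (s : ℝ) (hs0 : 0 ≤ s) :
    Real.exp (-(c * s ^ d)) + c * s ^ d - c * (d / (d + 1)) * s ^ (d + 1) ≤ 1 := by
  have hd' : (2 : ℝ) ≤ d := by exact_mod_cast hd
  rcases hs0.eq_or_lt with h | hs
  · subst h
    simp [show d ≠ 0 by omega]
  by_contra hcon
  push Not at hcon
  set u := c * s ^ d with hu
  have hu0 : 0 < u := by positivity
  have hm := mpos u hu0
  have hmin := u_min d hd' td htd hroot u hu0
  set us := -Real.log td with hus
  have hus0 : 0 < us := by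
    have := Real.log_neg htd.1 htd.2
    linarith
  -- us - 1 + td = us * d/(d+1) * (1-td)
  have heq : us - 1 + td = us * (d / (d + 1)) * (1 - td) := by
    field_simp
    have : Real.log td = - us := by rw [hus]; ring
    rw [this] at hroot
    linarith
  have htd1 : 0 < 1 - td := by linarith [htd.2]
  -- s < ((d+1)/d) m(u)/u
  have hlt : u * (d / (d + 1)) * s < u - 1 + Real.exp (-u) := by
    have : c * (d / (d + 1)) * s ^ (d + 1) = u * (d / (d + 1)) * s := by rw [hu]; ring
    linarith
  have hk : (0 : ℝ) < d / (d + 1) := by positivity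
  have hlog := Real.log_lt_log (by positivity) hlt
  rw [heq] at hmin
  have e1 : Real.log (us * (d / (d + 1)) * (1 - td)) =
      Real.log us + Real.log (d / (d + 1)) + Real.log (1 - td) := by
    rw [Real.log_mul (by positivity) (by positivity), Real.log_mul (by positivity) (by positivity)]
  have e2 : Real.log (u * (d / (d + 1)) * s) =
      Real.log u + Real.log (d / (d + 1)) + Real.log s := by
    rw [Real.log_mul (by positivity) (by positivity), Real.log_mul (by positivity) (by positivity)]
  rw [e1] at hmin
  rw [e2] at hlog
  have e3 : Real.log u = Real.log c + d * Real.log s := by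
    rw [hu, Real.log_mul (by positivity) (by positivity), Real.log_pow]
  have hc' := Real.log_lt_log hc0 hc
  rw [Real.log_div (by positivity) (by positivity), Real.log_pow] at hc'
  have := mul_lt_mul_of_pos_left hlog (show (0 : ℝ) < d by linarith)
  nlinarith
end

noncomputable section
set_option linter.unusedSectionVars false

/-! ### Finite probability spaces -/

/-- product weight -/
def piw {ι α : Type} [Fintype ι] (w : α → ℝ) (f : ι → α) : ℝ := ∏ i, w (f i)

/-- weight on `Option α` -/
def optw {α : Type} (p : ℝ) (w : α → ℝ) : Option α → ℝ
  | none => 1 - p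
  | some a => p * w a

structure IsProb {α : Type} [Fintype α] (w : α → ℝ) : Prop where
  nonneg : ∀ a, 0 ≤ w a
  sum_one : ∑ a, w a = 1

/-- expectation -/
def Ex {α : Type} [Fintype α] (w : α → ℝ) (f : α → ℝ) : ℝ := ∑ a, w a * f a

section basic
variable {α ι : Type} [Fintype α] [Fintype ι] [DecidableEq ι] {w : α → ℝ}

lemma Ex_add (w f g : α → ℝ) : Ex w (fun a => f a + g a) = Ex w f + Ex w g := by
  simp [Ex, mul_add, Finset.sum_add_distrib]

lemma Ex_sub (w f g : α → ℝ) : Ex w (fun a => f a - g a) = Ex w f - Ex w g := by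
  simp [Ex, mul_sub, Finset.sum_sub_distrib]

lemma Ex_mul_left (w f : α → ℝ) (r : ℝ) : Ex w (fun a => r * f a) = r * Ex w f := by
  simp only [Ex, Finset.mul_sum]
  refine Finset.sum_congr rfl fun a _ => by ring

lemma Ex_mul_right (w f : α → ℝ) (r : ℝ) : Ex w (fun a => f a * r) = Ex w f * r := by
  simp only [Ex, Finset.sum_mul]
  refine Finset.sum_congr rfl fun a _ => by ring

lemma Ex_sum {κ : Type} (s : Finset κ) (w : α → ℝ) (f : κ → α → ℝ) :
    Ex w (fun a => ∑ k ∈ s, f k a) = ∑ k ∈ s, Ex w (f k) := by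
  simp only [Ex, Finset.mul_sum]
  rw [Finset.sum_comm]

lemma Ex_const (hw : IsProb w) (r : ℝ) : Ex w (fun _ => r) = r := by
  simp [Ex, ← Finset.sum_mul, hw.sum_one]

lemma Ex_zero (w : α → ℝ) : Ex w (fun _ => 0) = 0 := by simp [Ex]

lemma Ex_mono (hw : IsProb w) {f g : α → ℝ} (h : ∀ a, f a ≤ g a) : Ex w f ≤ Ex w g :=
  Finset.sum_le_sum fun a _ => mul_le_mul_of_nonneg_left (h a) (hw.nonneg a)

lemma Ex_nonneg (hw : IsProb w) {f : α → ℝ} (h : ∀ a, 0 ≤ f a) : 0 ≤ Ex w f :=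
  Finset.sum_nonneg fun a _ => mul_nonneg (hw.nonneg a) (h a)

lemma IsProb.nonempty (hw : IsProb w) : Nonempty α := by
  by_contra h
  rw [not_nonempty_iff] at h
  have := hw.sum_one
  simp at this

lemma Ex_pi_prod (w : α → ℝ) (g : ι → α → ℝ) :
    Ex (piw (ι := ι) w) (fun f => ∏ i, g i (f i)) = ∏ i, Ex w (g i) := by
  simp only [Ex, piw, ← Finset.prod_mul_distrib]
  rw [Finset.prod_univ_sum, Fintype.piFinset_univ]

lemma piw_prob (hw : IsProb w) : IsProb (piw (ι := ι) w) := by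
  constructor
  · intro f
    exact Finset.prod_nonneg fun i _ => hw.nonneg _
  · have := Ex_pi_prod (ι := ι) w (fun _ _ => 1)
    simpa [Ex, hw.sum_one] using this

lemma optw_prob {p : ℝ} (hp0 : 0 ≤ p) (hp1 : p ≤ 1) (hw : IsProb w) : IsProb (optw p w) := by
  constructor
  · intro a
    cases a with
    | none => simp [optw]; linarith
    | some a => exact mul_nonneg hp0 (hw.nonneg a)
  · rw [Fintype.sum_option]
    simp only [optw, ← Finset.mul_sum, hw.sum_one]
    ring

lemma Ex_opt (p : ℝ) (w : α → ℝ) (f : Option α → ℝ) :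
    Ex (optw p w) f = (1 - p) * f none + p * Ex w (fun a => f (some a)) := by
  simp only [Ex, Fintype.sum_option, optw, Finset.mul_sum, mul_assoc]

lemma Ex_pi_split (hw : IsProb w) (v : ι) (b : α) (F : α → (ι → α) → ℝ) :
    Ex (piw (ι := ι) w) (fun T => F (T v) (Function.update T v b)) =
    Ex w (fun a => Ex (piw (ι := ι) w) (fun T => F a (Function.update T v b))) := by
  have key : ∀ H : α → (ι → α) → ℝ,
      Ex (piw (ι := ι) w) (fun T => H (T v) (Function.update T v b)) =
      ∑ a, ∑ T : {j // j ≠ v} → α, w a * (∏ j, w (T j)) *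
        H a (fun j => if h : j = v then b else T ⟨j, h⟩) := by
    intro H
    rw [← Fintype.sum_prod_type'
      (f := fun (a : α) (T : {j // j ≠ v} → α) => w a * (∏ j, w (T j)) *
        H a (fun j => if h : j = v then b else T ⟨j, h⟩))]
    unfold Ex
    apply Fintype.sum_equiv (Equiv.funSplitAt v α)
    intro T
    have h1 : piw w T = w (T v) * ∏ j : {j // j ≠ v}, w (T j) := by
      unfold piw
      rw [← Finset.prod_subtype (s := Finset.univ.erase v) (p := fun j => j ≠ v)
        (by simp) (fun j => w (T j)), Finset.mul_prod_erase _ (fun j => w (T j)) (Finset.mem_univ v)]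
    rw [h1]
    simp only [Equiv.funSplitAt_apply]
    congr 2
    funext j
    by_cases h : j = v
    · simp [h]
    · simp [h]
  rw [key F]
  have hun : ∀ f : α → ℝ, Ex w f = ∑ a, w a * f a := fun f => rfl
  rw [hun]
  refine Finset.sum_congr rfl fun a _ => ?_
  have hk := key (fun _ T => F a T)
  rw [hk, Finset.sum_comm, Finset.mul_sum]
  refine Finset.sum_congr rfl fun T _ => ?_
  rw [← Finset.sum_mul, ← Finset.sum_mul, hw.sum_one]
  ring

lemma Ex_pi_single (hw : IsProb w) (v : ι) (f : α → ℝ) :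
    Ex (piw (ι := ι) w) (fun T => f (T v)) = Ex w f := by
  obtain ⟨b⟩ := hw.nonempty
  have := Ex_pi_split (ι := ι) hw v b (fun a _ => f a)
  simp only [Ex_const (piw_prob hw)] at this
  exact this

lemma Ex_pi_two (hw : IsProb w) {v v' : ι} (hv : v ≠ v') (f g : α → ℝ) :
    Ex (piw (ι := ι) w) (fun T => f (T v) * g (T v')) = Ex w f * Ex w g := by
  obtain ⟨b⟩ := hw.nonempty
  have := Ex_pi_split (ι := ι) hw v b (fun a T => f a * g (T v'))
  simp only [Function.update_of_ne hv.symm, Ex_mul_left, Ex_mul_right,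
    Ex_pi_single hw v' g] at this
  exact this

end basic

/-! ### One step of the recursion -/

section onestep
variable {α : Type} [Fintype α] {n d : ℕ}

def Sg (Z : α → ℝ) (g : Fin d → α) : ℝ := ∑ i, Z (g i)

def oinv (Z : α → ℝ) : Option (Fin d → α) → ℝ
  | none => 0
  | some g => 1 / Sg Z g

def Yst (Z : α → ℝ) (T : Fin n → Option (Fin d → α)) : ℝ := 1 / (1 + ∑ v, oinv Z (T v))

def stepw (n d : ℕ) (p : ℝ) (w : α → ℝ) : (Fin n → Option (Fin d → α)) → ℝ :=
  piw (optw p (piw w))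

def bO (Z : α → ℝ) (δ : ℝ) : Option (Fin d → α) → ℝ
  | none => 1
  | some g => if δ < Sg Z g then 1 else 0

def gI (Z : α → ℝ) (δ : ℝ) (T : Fin n → Option (Fin d → α)) : ℝ := ∏ v, bO Z δ (T v)

lemma oinv_some (Z : α → ℝ) (g : Fin d → α) : oinv Z (some g) = 1 / Sg Z g := rfl
lemma bO_some (Z : α → ℝ) (δ : ℝ) (g : Fin d → α) :
    bO Z δ (some g) = if δ < Sg Z g then 1 else 0 := rfl
lemma Sg_pos (hd : 0 < d) {Z : α → ℝ} (hZ : ∀ a, 0 < Z a) (g : Fin d → α) : 0 < Sg Z g := by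
  have : Nonempty (Fin d) := ⟨⟨0, hd⟩⟩
  exact Finset.sum_pos (fun i _ => hZ _) Finset.univ_nonempty

lemma oinv_nonneg (hd : 0 < d) {Z : α → ℝ} (hZ : ∀ a, 0 < Z a) (o : Option (Fin d → α)) :
    0 ≤ oinv Z o := by
  cases o with
  | none => exact le_rfl
  | some g => exact (one_div_pos.mpr (Sg_pos hd hZ g)).le

lemma Yst_pos (hd : 0 < d) {Z : α → ℝ} (hZ : ∀ a, 0 < Z a) (T : Fin n → Option (Fin d → α)) :
    0 < Yst Z T := by
  have : 0 ≤ ∑ v, oinv Z (T v) := Finset.sum_nonneg fun v _ => oinv_nonneg hd hZ _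
  unfold Yst
  positivity

lemma Yst_le_one (hd : 0 < d) {Z : α → ℝ} (hZ : ∀ a, 0 < Z a) (T : Fin n → Option (Fin d → α)) :
    Yst Z T ≤ 1 := by
  have : 0 ≤ ∑ v, oinv Z (T v) := Finset.sum_nonneg fun v _ => oinv_nonneg hd hZ _
  unfold Yst
  rw [div_le_one (by positivity)]
  linarith

lemma sum_upd (Z : α → ℝ) (T : Fin n → Option (Fin d → α)) (v : Fin n) :
    ∑ w, oinv Z (T w) = oinv Z (T v) + ∑ w, oinv Z (Function.update T v none w) := by
  rw [Fintype.sum_eq_add_sum_compl v, Fintype.sum_eq_add_sum_compl v (fun w =>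
    oinv Z (Function.update T v none w))]
  have : ∑ i ∈ {v}ᶜ, oinv Z (Function.update T v none i) = ∑ i ∈ {v}ᶜ, oinv Z (T i) := by
    refine Finset.sum_congr rfl fun i hi => ?_
    rw [Function.update_of_ne]
    simpa using hi
  rw [this]
  simp [oinv]

lemma gI_upd (Z : α → ℝ) (δ : ℝ) (T : Fin n → Option (Fin d → α)) (v : Fin n) :
    gI Z δ T = bO Z δ (T v) * gI Z δ (Function.update T v none) := by
  unfold gI
  rw [Fintype.prod_eq_mul_prod_compl v, Fintype.prod_eq_mul_prod_compl v (fun w =>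
    bO Z δ (Function.update T v none w))]
  have : ∏ i ∈ {v}ᶜ, bO Z δ (Function.update T v none i) = ∏ i ∈ {v}ᶜ, bO Z δ (T i) := by
    refine Finset.prod_congr rfl fun i hi => ?_
    rw [Function.update_of_ne]
    simpa using hi
  rw [this]
  simp [bO]

lemma Yst_upd (hd : 0 < d) {Z : α → ℝ} (hZ : ∀ a, 0 < Z a) (T : Fin n → Option (Fin d → α))
    (v : Fin n) : Yst Z T ≤ Yst Z (Function.update T v none) := by
  have h0 : 0 ≤ ∑ w, oinv Z (Function.update T v none w) :=
    Finset.sum_nonneg fun v _ => oinv_nonneg hd hZ _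
  unfold Yst
  rw [sum_upd Z T v]
  apply one_div_le_one_div_of_le (by positivity)
  have := oinv_nonneg hd hZ (T v)
  linarith

lemma bO_cases (Z : α → ℝ) (δ : ℝ) (o : Option (Fin d → α)) : bO Z δ o = 0 ∨ bO Z δ o = 1 := by
  cases o with
  | none => right; rfl
  | some g =>
    simp only [bO]
    split_ifs <;> simp

lemma gI_cases (Z : α → ℝ) (δ : ℝ) (T : Fin n → Option (Fin d → α)) :
    gI Z δ T = 0 ∨ gI Z δ T = 1 := by
  by_cases h : ∃ v, bO Z δ (T v) = 0
  · obtain ⟨v, hv⟩ := h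
    left
    exact Finset.prod_eq_zero (Finset.mem_univ v) hv
  · right
    push Not at h
    exact Finset.prod_eq_one fun v _ => (bO_cases Z δ (T v)).resolve_left (h v)

lemma gI_zero (hd : 0 < d) {Z : α → ℝ} (hZ : ∀ a, 0 < Z a) (δ : ℝ)
    (T : Fin n → Option (Fin d → α)) (h : gI Z δ T = 0) : Yst Z T ≤ δ := by
  obtain ⟨v, -, hv⟩ := Finset.prod_eq_zero_iff.mp h
  have h0 : 0 ≤ ∑ w, oinv Z (Function.update T v none w) :=
    Finset.sum_nonneg fun v _ => oinv_nonneg hd hZ _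
  unfold Yst
  rw [sum_upd Z T v]
  cases hT : T v with
  | none => rw [hT] at hv; simp [bO] at hv
  | some g =>
    rw [hT] at hv
    simp only [bO] at hv
    have hS : Sg Z g ≤ δ := by
      by_contra hc
      push Not at hc
      simp [hc] at hv
    have hp := Sg_pos hd hZ g
    rw [oinv_some]
    calc 1 / (1 + (1 / Sg Z g + _)) ≤ 1 / (1 / Sg Z g) :=
          one_div_le_one_div_of_le (by positivity) (by linarith)
      _ = Sg Z g := by rw [one_div_one_div]
      _ ≤ δ := hS

/-- the Palm summand -/
def palmT (Z : α → ℝ) (δ : ℝ) : Option (Fin d → α) → (Fin n → Option (Fin d → α)) → ℝ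
  | none, _ => 0
  | some g, T => if δ < Sg Z g then Yst Z T / (Sg Z g + Yst Z T) - min 1 (δ / Sg Z g) else 0

lemma palm_pointwise (hd : 0 < d) {Z : α → ℝ} (hZ : ∀ a, 0 < Z a) {δ : ℝ} (hδ : 0 < δ)
    (T : Fin n → Option (Fin d → α)) :
    ∑ v, palmT Z δ (T v) (Function.update T v none) ≤ (1 - Yst Z T) * gI Z δ T := by
  have hs : 0 ≤ ∑ v, oinv Z (T v) := Finset.sum_nonneg fun v _ => oinv_nonneg hd hZ _
  have h1 : (1 - Yst Z T) * gI Z δ T =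
      ∑ v, oinv Z (T v) / (1 + ∑ v, oinv Z (T v)) * gI Z δ T := by
    rw [← Finset.sum_mul, ← Finset.sum_div]
    unfold Yst
    congr 1
    field_simp
    ring
  rw [h1]
  refine Finset.sum_le_sum fun v _ => ?_
  rw [gI_upd Z δ T v, sum_upd Z T v]
  set T' := Function.update T v none with hT'
  have hs' : 0 ≤ ∑ v, oinv Z (T' v) := Finset.sum_nonneg fun v _ => oinv_nonneg hd hZ _
  have hY := Yst_pos hd hZ T'
  cases hT : T v with
  | none => simp [palmT, oinv]
  | some g =>
    have hS := Sg_pos hd hZ g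
    rw [oinv_some, bO_some]
    simp only [palmT]
    split_ifs with hlt
    · have e : 1 / Sg Z g / (1 + (1 / Sg Z g + ∑ w, oinv Z (T' w))) =
          Yst Z T' / (Sg Z g + Yst Z T') := by
        unfold Yst
        field_simp
        ring
      rw [e, one_mul]
      rcases gI_cases Z δ T' with h | h
      · rw [h, mul_zero]
        have hle := gI_zero hd hZ δ T' h
        have : Yst Z T' / (Sg Z g + Yst Z T') ≤ min 1 (δ / Sg Z g) := by
          apply le_min
          · rw [div_le_one (by positivity)]; linarith
          · apply div_le_div₀ (by positivity) hle hS (by linarith)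
        linarith
      · rw [h, mul_one]
        have : 0 ≤ min 1 (δ / Sg Z g) := le_min zero_le_one (by positivity)
        linarith
    · simp

lemma stepw_prob {p : ℝ} (hp0 : 0 ≤ p) (hp1 : p ≤ 1) {w : α → ℝ} (hw : IsProb w) :
    IsProb (stepw n d p w) := piw_prob (optw_prob hp0 hp1 (piw_prob hw))

lemma ratio_lip {S Y Z δ : ℝ} (hδ : 0 < δ) (hS : δ < S) (hY : 0 < Y) (hYZ : Y ≤ Z) :
    Z / (S + Z) - (Z - Y) / δ ≤ Y / (S + Y) := by
  have hS0 : 0 < S := hδ.trans hS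
  have hZ : 0 < Z := hY.trans_le hYZ
  have h1 : Z / (S + Z) - Y / (S + Y) = (Z - Y) * (S / ((S + Z) * (S + Y))) := by
    field_simp
    ring
  have h2 : S / ((S + Z) * (S + Y)) ≤ 1 / δ := by
    rw [div_le_div_iff₀ (by positivity) hδ]
    nlinarith [mul_pos hS0 hZ, mul_pos hS0 hY, mul_pos hZ hY]
  have h3 := mul_le_mul_of_nonneg_left h2 (sub_nonneg.mpr hYZ)
  have h4 : (Z - Y) / δ = (Z - Y) * (1 / δ) := by ring
  linarith

lemma gI_exp {p : ℝ} (hp0 : 0 ≤ p) (hp1 : p ≤ 1) {w : α → ℝ} (hw : IsProb w) (Z : α → ℝ) (δ : ℝ) :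
    Ex (stepw n d p w) (gI Z δ) ≤
      Real.exp (-(n * p * Ex (piw (ι := Fin d) w) (fun g => if Sg Z g ≤ δ then 1 else 0))) := by
  set u := Ex (piw (ι := Fin d) w) (fun g => if Sg Z g ≤ δ then (1 : ℝ) else 0) with hu
  have h1 : Ex (stepw n d p w) (gI Z δ) = (1 - p * u) ^ n := by
    have := Ex_pi_prod (ι := Fin n) (optw p (piw (ι := Fin d) w)) (fun _ o => bO Z δ o)
    unfold stepw
    refine this.trans ?_
    rw [Finset.prod_const, Finset.card_univ, Fintype.card_fin, Ex_opt]
    congr 1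
    have : Ex (piw (ι := Fin d) w) (fun g => bO Z δ (some g)) = 1 - u := by
      refine Eq.trans ?_ (congrArg (· - u) (Ex_const (piw_prob (ι := Fin d) hw) 1))
      rw [hu]
      rw [← Ex_sub]
      congr 1
      funext g
      simp only [bO]
      by_cases h : δ < Sg Z g
      · simp [h, not_le.mpr h]
      · simp [h, not_lt.mp h]
    rw [this]
    simp only [bO]
    ring
  have hu0 : 0 ≤ u := Ex_nonneg (piw_prob hw) fun g => by split_ifs <;> norm_num
  have hu1 : u ≤ 1 := by
    refine le_trans ?_ (Ex_const (piw_prob (ι := Fin d) hw) 1).le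
    exact Ex_mono (piw_prob hw) fun g => by split_ifs <;> norm_num
  rw [h1]
  have h2 : 1 - p * u ≤ Real.exp (-(p * u)) := by
    have := Real.add_one_le_exp (-(p * u))
    linarith
  have h3 : 0 ≤ 1 - p * u := by nlinarith
  calc (1 - p * u) ^ n ≤ (Real.exp (-(p * u))) ^ n := pow_le_pow_left₀ h3 h2 n
    _ = _ := by rw [← Real.exp_nat_mul]; congr 1; ring

/-- One step inequality. -/
lemma onestep {p : ℝ} (hp0 : 0 ≤ p) (hp1 : p ≤ 1) (hd : 0 < d) {w : α → ℝ} (hw : IsProb w)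
    {Z : α → ℝ} (hZ : ∀ a, 0 < Z a) (tr : (Fin n → Option (Fin d → α)) → α)
    (htr : ∀ f : α → ℝ, Ex (stepw n d p w) (fun T => f (tr T)) = Ex w f)
    (hle : ∀ T, Yst Z T ≤ Z (tr T)) {δ : ℝ} (hδ : 0 < δ) :
    Ex (stepw n d p w) (Yst Z) ≤ δ +
      Real.exp (-(n * p * Ex (piw (ι := Fin d) w) (fun g => if Sg Z g ≤ δ then 1 else 0)))
      - n * p * (Ex (piw (ι := Fin d) w) (fun g => Ex w (fun a =>
            if δ < Sg Z g then Z a / (Sg Z g + Z a) else 0))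
          - Ex (piw (ι := Fin d) w) (fun g => if δ < Sg Z g then min 1 (δ / Sg Z g) else 0)
          - (Ex w Z - Ex (stepw n d p w) (Yst Z)) / δ) := by
  have hW := stepw_prob (n := n) (d := d) hp0 hp1 hw
  have hP := piw_prob (ι := Fin d) hw
  have hO := optw_prob hp0 hp1 hP
  set D := Ex w Z - Ex (stepw n d p w) (Yst Z) with hD
  have hD' : D = Ex (stepw n d p w) (fun T => Z (tr T) - Yst Z T) := by
    rw [Ex_sub, htr]
  have hD0 : 0 ≤ D := by
    rw [hD']
    exact Ex_nonneg hW fun T => by linarith [hle T]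
  have h1 : Ex (stepw n d p w) (Yst Z) ≤
      Ex (stepw n d p w) (fun T => δ + gI Z δ T -
        ∑ v, palmT Z δ (T v) (Function.update T v none)) := by
    apply Ex_mono hW
    intro T
    have := palm_pointwise hd hZ hδ T
    rcases gI_cases Z δ T with h | h
    · have h2 := gI_zero hd hZ δ T h
      rw [h] at this ⊢
      linarith
    · rw [h] at this ⊢
      linarith
  rw [Ex_sub, Ex_add, Ex_const hW, Ex_sum] at h1
  have h2 := gI_exp (n := n) (d := d) hp0 hp1 hw Z δ
  set R := Ex (piw (ι := Fin d) w) (fun g => Ex w (fun a =>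
            if δ < Sg Z g then Z a / (Sg Z g + Z a) else 0))
          - Ex (piw (ι := Fin d) w) (fun g => if δ < Sg Z g then min 1 (δ / Sg Z g) else 0)
          - D / δ with hR
  have h3 : ∀ v : Fin n, p * R ≤
      Ex (stepw n d p w) (fun T => palmT Z δ (T v) (Function.update T v none)) := by
    intro v
    have e1 : Ex (stepw n d p w) (fun T => palmT Z δ (T v) (Function.update T v none)) = _ :=
      Ex_pi_split hO v none (fun a T => palmT Z δ a T)
    rw [e1, Ex_opt]
    have e2 : Ex (piw (ι := Fin n) (optw p (piw (ι := Fin d) w)))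
        (fun T => palmT Z δ none (Function.update T v none)) = 0 := by
      simp only [palmT]
      exact Ex_zero _
    rw [e2, mul_zero, zero_add]
    apply mul_le_mul_of_nonneg_left _ hp0
    have e3 : R = Ex (piw (ι := Fin d) w) (fun g => Ex w (fun a =>
            if δ < Sg Z g then Z a / (Sg Z g + Z a) else 0)
          - (if δ < Sg Z g then min 1 (δ / Sg Z g) else 0) - D / δ) := by
      rw [Ex_sub, Ex_sub, Ex_const hP]
    rw [e3]
    apply Ex_mono hP
    intro g
    by_cases hg : δ < Sg Z g
    · simp only [hg, if_true, palmT]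
      have e4 : Ex w (fun a => Z a / (Sg Z g + Z a)) - min 1 (δ / Sg Z g) - D / δ =
          Ex (stepw n d p w) (fun T => Z (tr T) / (Sg Z g + Z (tr T)) - min 1 (δ / Sg Z g)
            - (Z (tr T) - Yst Z T) * (1 / δ)) := by
        rw [Ex_sub, Ex_sub, Ex_const hW, Ex_mul_right, ← hD',
          htr (fun a => Z a / (Sg Z g + Z a))]
        ring
      rw [e4]
      apply Ex_mono hW
      intro T
      have a1 := ratio_lip hδ hg (Yst_pos hd hZ T) (hle T)
      have a2 : Yst Z T / (Sg Z g + Yst Z T) ≤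
          Yst Z (Function.update T v none) / (Sg Z g + Yst Z (Function.update T v none)) := by
        have b1 := Yst_upd hd hZ T v
        have b2 := Yst_pos hd hZ T
        have b3 := Yst_pos hd hZ (Function.update T v none)
        have b4 := Sg_pos hd hZ g
        rw [div_le_div_iff₀ (by positivity) (by positivity)]
        nlinarith
      have a3 : (Z (tr T) - Yst Z T) * (1 / δ) = (Z (tr T) - Yst Z T) / δ := by ring
      linarith
    · simp only [hg, if_false, palmT, Ex_zero]
      have : 0 ≤ D / δ := by positivity
      linarith
  have h4 : (n : ℝ) * p * R ≤ ∑ v : Fin n,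
      Ex (stepw n d p w) (fun T => palmT Z δ (T v) (Function.update T v none)) := by
    calc (n : ℝ) * p * R = ∑ v : Fin n, p * R := by
          rw [Finset.sum_const, Finset.card_univ, Fintype.card_fin, nsmul_eq_mul]; ring
      _ ≤ _ := Finset.sum_le_sum fun v _ => h3 v
  linarith

end onestep
end

noncomputable section

section onestep
variable {α : Type} [Fintype α] {n d : ℕ}

lemma Ex_cons (w : α → ℝ) (H : (Fin (d + 1) → α) → ℝ) :
    Ex (piw (ι := Fin (d + 1)) w) H =
    Ex (piw (ι := Fin d) w) (fun g => Ex w (fun a => H (Fin.cons a g))) := by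
  have h1 : Ex (piw (ι := Fin d) w) (fun g => Ex w (fun a => H (Fin.cons a g))) =
      ∑ a, ∑ g : Fin d → α, (w a * ∏ i, w (g i)) * H (Fin.cons a g) := by
    simp only [Ex, Finset.mul_sum, piw]
    rw [Finset.sum_comm]
    refine Finset.sum_congr rfl fun a _ => Finset.sum_congr rfl fun g _ => by ring
  rw [h1, ← Fintype.sum_prod_type'
    (f := fun (a : α) (g : Fin d → α) => (w a * ∏ i, w (g i)) * H (Fin.cons a g))]
  unfold Ex
  symm
  apply Fintype.sum_equiv (Fin.consEquiv (fun _ => α))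
  rintro ⟨a, g⟩
  simp [piw, Fin.prod_univ_succ, Fin.consEquiv]

lemma Ex_perm {ι : Type} [Fintype ι] [DecidableEq ι] (w : α → ℝ) (e : ι ≃ ι)
    (H : (ι → α) → ℝ) :
    Ex (piw (ι := ι) w) (fun q => H (q ∘ e)) = Ex (piw (ι := ι) w) H := by
  unfold Ex
  apply Fintype.sum_equiv (e.symm.arrowCongr (Equiv.refl α))
  intro q
  have h1 : (e.symm.arrowCongr (Equiv.refl α)) q = q ∘ e := by
    funext i
    simp [Equiv.arrowCongr]
  rw [h1]
  congr 1
  unfold piw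
  exact (Equiv.prod_comp e (fun i => w (q i))).symm

lemma sym_exact {w : α → ℝ} {Z : α → ℝ} (hZ : ∀ a, 0 < Z a) (δ : ℝ) :
    ((d : ℝ) + 1) * Ex (piw (ι := Fin d) w) (fun g => Ex w (fun a =>
        if δ < Sg Z g + Z a then Z a / (Sg Z g + Z a) else 0)) =
    Ex (piw (ι := Fin d) w) (fun g => Ex w (fun a => if δ < Sg Z g + Z a then 1 else 0)) := by
  set f : Fin (d + 1) → (Fin (d + 1) → α) → ℝ := fun i q =>
    if δ < Sg Z q then Z (q i) / Sg Z q else 0 with hf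
  have hS : ∀ a (g : Fin d → α), Sg Z (Fin.cons a g : Fin (d + 1) → α) = Sg Z g + Z a := by
    intro a g
    simp [Sg, Fin.sum_univ_succ, add_comm]
  have h0 : Ex (piw (ι := Fin d) w) (fun g => Ex w (fun a =>
        if δ < Sg Z g + Z a then Z a / (Sg Z g + Z a) else 0)) =
      Ex (piw (ι := Fin (d + 1)) w) (f 0) := by
    rw [Ex_cons]
    simp only [hf, hS, Fin.cons_zero]
  have h1 : Ex (piw (ι := Fin d) w) (fun g => Ex w (fun a =>
        if δ < Sg Z g + Z a then (1 : ℝ) else 0)) =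
      Ex (piw (ι := Fin (d + 1)) w) (fun q => if δ < Sg Z q then (1 : ℝ) else 0) := by
    rw [Ex_cons]
    simp only [hS]
  have h2 : ∀ i, Ex (piw (ι := Fin (d + 1)) w) (f i) = Ex (piw (ι := Fin (d + 1)) w) (f 0) := by
    intro i
    rw [← Ex_perm w (Equiv.swap 0 i) (f 0)]
    congr 1
    funext q
    have : Sg Z (q ∘ Equiv.swap 0 i) = Sg Z q := by
      unfold Sg
      exact Equiv.sum_comp (Equiv.swap 0 i) (fun j => Z (q j))
    simp only [hf, this, Function.comp, Equiv.swap_apply_left]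
  have h3 : ∑ i, Ex (piw (ι := Fin (d + 1)) w) (f i) =
      Ex (piw (ι := Fin (d + 1)) w) (fun q => if δ < Sg Z q then (1 : ℝ) else 0) := by
    rw [← Ex_sum]
    congr 1
    funext q
    simp only [hf]
    split_ifs with h
    · rw [← Finset.sum_div]
      have := Sg_pos (Nat.succ_pos d) hZ q
      exact div_self this.ne'
    · simp
  rw [h0, h1, ← h3]
  simp only [h2]
  simp

lemma pow_diff {a b : ℝ} (ha : 0 ≤ a) (hab : a ≤ b) (hb : b ≤ 1) (m : ℕ) :
    b ^ m - a ^ m ≤ m * (b - a) := by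
  induction m with
  | zero => simp
  | succ m ih =>
    have h1 : b ^ m ≤ 1 := pow_le_one₀ (ha.trans hab) hb
    have h2 : a ^ m ≤ 1 := pow_le_one₀ ha (hab.trans hb)
    have h3 : 0 ≤ a ^ m := pow_nonneg ha m
    have e : b ^ (m + 1) - a ^ (m + 1) = b * (b ^ m - a ^ m) + a ^ m * (b - a) := by ring
    have h4 : b * (b ^ m - a ^ m) ≤ 1 * (b ^ m - a ^ m) :=
      mul_le_mul_of_nonneg_right hb (sub_nonneg.mpr (pow_le_pow_left₀ ha hab m))
    have h5 : a ^ m * (b - a) ≤ 1 * (b - a) :=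
      mul_le_mul_of_nonneg_right h2 (by linarith)
    push_cast
    linarith

lemma exp_add_mono {x y : ℝ} (hx : 0 ≤ x) (hxy : x ≤ y) :
    Real.exp (-x) + x ≤ Real.exp (-y) + y := by
  have h1 := Real.add_one_le_exp (-(y - x))
  have h2 : Real.exp (-y) = Real.exp (-x) * Real.exp (-(y - x)) := by
    rw [← Real.exp_add]; congr 1; ring
  have h3 : Real.exp (-x) ≤ 1 := Real.exp_le_one_iff.mpr (by linarith)
  have h4 := Real.exp_pos (-x)
  nlinarith

/-- One-step inequality, packaged. -/
lemma onestep2 {p c : ℝ} (hp0 : 0 ≤ p) (hp1 : p ≤ 1) (hc : n * p = c) (hd : 0 < d)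
    {w : α → ℝ} (hw : IsProb w)
    {Z : α → ℝ} (hZ : ∀ a, 0 < Z a) (tr : (Fin n → Option (Fin d → α)) → α)
    (htr : ∀ f : α → ℝ, Ex (stepw n d p w) (fun T => f (tr T)) = Ex w f)
    (hle : ∀ T, Yst Z T ≤ Z (tr T)) {δ η : ℝ} (hδ : 0 < δ) (hη : 0 < η)
    (hη1 : η * (d + 1) ≤ 1)
    (hψ : ∀ s : ℝ, 0 ≤ s →
      Real.exp (-(c * s ^ d)) + c * s ^ d - c * (d / (d + 1)) * s ^ (d + 1) ≤ 1) :
    Ex (stepw n d p w) (Yst Z) ≤ 1 - c / (d + 1) + δ + c * η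
      + 2 * c * d * Ex w (fun a => if η * δ < Z a ∧ Z a ≤ δ / η then 1 else 0)
      + c * ((Ex w Z - Ex (stepw n d p w) (Yst Z)) / δ) := by
  have h1 := onestep hp0 hp1 hd hw hZ tr htr hle hδ
  have hP := piw_prob (ι := Fin d) hw
  have hd' : (1 : ℝ) ≤ d := by exact_mod_cast hd
  have hη1' : η ≤ 1 := by nlinarith
  rw [hc] at h1
  have hc0 : 0 ≤ c := by rw [← hc]; positivity
  set u := Ex (piw (ι := Fin d) w) (fun g => if Sg Z g ≤ δ then (1 : ℝ) else 0) with hu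
  set h := Ex (piw (ι := Fin d) w) (fun g => Ex w (fun a =>
    if Sg Z g + Z a ≤ δ then (1 : ℝ) else 0)) with hh
  set s := Ex w (fun a => if Z a ≤ δ then (1 : ℝ) else 0) with hs
  set s' := Ex w (fun a => if Z a ≤ η * δ then (1 : ℝ) else 0) with hs'
  set ε := Ex w (fun a => if η * δ < Z a ∧ Z a ≤ δ / η then (1 : ℝ) else 0) with hε
  set M := Ex (piw (ι := Fin d) w) (fun g => if δ < Sg Z g then min 1 (δ / Sg Z g) else 0) with hM
  set A := Ex (piw (ι := Fin d) w) (fun g => Ex w (fun a =>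
            if δ < Sg Z g then Z a / (Sg Z g + Z a) else 0)) with hA
  set D := Ex w Z - Ex (stepw n d p w) (Yst Z) with hD
  have hs'0 : 0 ≤ s' := Ex_nonneg hw fun a => by split_ifs <;> norm_num
  have hs1 : s ≤ 1 := by
    refine le_trans ?_ (Ex_const hw 1).le
    exact Ex_mono hw fun g => by split_ifs <;> norm_num
  have hηδ : η * δ ≤ δ := by nlinarith
  have hδη : δ ≤ δ / η := by rw [le_div_iff₀ hη]; nlinarith
  have hss : s' ≤ s := by
    apply Ex_mono hw
    intro a
    by_cases h2 : Z a ≤ η * δ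
    · simp [h2, h2.trans hηδ]
    · simp only [h2, if_false]; split_ifs <;> norm_num
  have hsε : s ≤ s' + ε := by
    rw [hs', hε, ← Ex_add]
    apply Ex_mono hw
    intro a
    by_cases h2 : Z a ≤ δ
    · by_cases h3 : Z a ≤ η * δ
      · simp only [h2, h3, if_true]; split_ifs <;> norm_num
      · simp only [h2, h3, if_true, if_false, not_le.mp h3, h2.trans hδη, and_self]; norm_num
    · simp only [h2, if_false]; split_ifs <;> norm_num
  -- u ≤ s^d
  have hus : u ≤ s ^ d := by
    have e : s ^ d = Ex (piw (ι := Fin d) w) (fun g => ∏ i, if Z (g i) ≤ δ then (1 : ℝ) else 0) := by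
      rw [Ex_pi_prod w (fun (_ : Fin d) a => if Z a ≤ δ then (1 : ℝ) else 0)]
      simp [hs]
    rw [e]
    apply Ex_mono hP
    intro g
    split_ifs with h2
    · rw [Finset.prod_eq_one]
      intro i _
      rw [if_pos]
      refine le_trans ?_ h2
      exact Finset.single_le_sum (f := fun i => Z (g i)) (fun j _ => (hZ _).le) (Finset.mem_univ i)
    · exact Finset.prod_nonneg fun i _ => by split_ifs <;> norm_num
  have hu0 : 0 ≤ u := Ex_nonneg hP fun a => by split_ifs <;> norm_num
  -- h ≥ s'^(d+1)
  have hhs : s' ^ (d + 1) ≤ h := by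
    have e : s' ^ (d + 1) = Ex (piw (ι := Fin d) w) (fun g => Ex w (fun a =>
        (if Z a ≤ η * δ then (1 : ℝ) else 0) * ∏ i, if Z (g i) ≤ η * δ then (1 : ℝ) else 0)) := by
      simp only [Ex_mul_right, Ex_mul_left]
      rw [Ex_pi_prod w (fun (_ : Fin d) a => if Z a ≤ η * δ then (1 : ℝ) else 0)]
      rw [← hs', Finset.prod_const, Finset.card_univ, Fintype.card_fin, pow_succ]; ring
    rw [e]
    apply Ex_mono hP
    intro g
    apply Ex_mono hw
    intro a
    by_cases h2 : Z a ≤ η * δ ∧ ∀ i, Z (g i) ≤ η * δ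
    · have : Sg Z g + Z a ≤ δ := by
        have h3 : Sg Z g ≤ ∑ i : Fin d, η * δ := Finset.sum_le_sum fun i _ => h2.2 i
        simp only [Finset.sum_const, Finset.card_univ, Fintype.card_fin, nsmul_eq_mul] at h3
        nlinarith [h2.1]
      simp [h2.1, h2.2, this]
    · have : (if Z a ≤ η * δ then (1 : ℝ) else 0) *
          ∏ i, (if Z (g i) ≤ η * δ then (1 : ℝ) else 0) = 0 := by
        by_cases h3 : Z a ≤ η * δ
        · have : ∃ i, ¬ Z (g i) ≤ η * δ := by
            by_contra h4
            push Not at h4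
            exact h2 ⟨h3, h4⟩
          obtain ⟨i, hi⟩ := this
          rw [Finset.prod_eq_zero (Finset.mem_univ i) (by simp [not_le.mp hi]), mul_zero]
        · simp [not_le.mp h3]
      rw [this]
      split_ifs <;> norm_num
  -- M ≤ η + d ε
  have hMle : M ≤ η + d * ε := by
    have e : η + d * ε = Ex (piw (ι := Fin d) w) (fun g => η + ∑ i : Fin d,
        if η * δ < Z (g i) ∧ Z (g i) ≤ δ / η then (1 : ℝ) else 0) := by
      rw [Ex_add, Ex_const hP, Ex_sum]
      have : ∀ i : Fin d, Ex (piw (ι := Fin d) w) (fun g =>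
          if η * δ < Z (g i) ∧ Z (g i) ≤ δ / η then (1 : ℝ) else 0) = ε := fun i =>
        Ex_pi_single hw i (fun a => if η * δ < Z a ∧ Z a ≤ δ / η then (1 : ℝ) else 0)
      simp [this]
    rw [e]
    apply Ex_mono hP
    intro g
    have hnn : ∀ i : Fin d, (0 : ℝ) ≤ if η * δ < Z (g i) ∧ Z (g i) ≤ δ / η then (1 : ℝ) else 0 :=
      fun i => by split_ifs <;> norm_num
    split_ifs with h2
    · by_cases h3 : Sg Z g ≤ δ / η
      · have : ∃ i, η * δ < Z (g i) := by
          by_contra h4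
          push Not at h4
          have h5 : Sg Z g ≤ ∑ i : Fin d, η * δ := Finset.sum_le_sum fun i _ => h4 i
          simp only [Finset.sum_const, Finset.card_univ, Fintype.card_fin, nsmul_eq_mul] at h5
          nlinarith
        obtain ⟨i, hi⟩ := this
        have h6 : Z (g i) ≤ δ / η := le_trans (Finset.single_le_sum (f := fun i => Z (g i))
          (fun j _ => (hZ _).le) (Finset.mem_univ i)) h3
        have h7 := Finset.single_le_sum (f := fun i : Fin d =>
          if η * δ < Z (g i) ∧ Z (g i) ≤ δ / η then (1 : ℝ) else 0)
          (fun j _ => hnn j) (Finset.mem_univ i)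
        simp only [hi, h6, and_self, if_true] at h7
        have := min_le_left 1 (δ / Sg Z g)
        linarith
      · push Not at h3
        have h4 : δ / Sg Z g ≤ η := by
          rw [div_le_iff₀ (hδ.trans h2)]
          rw [div_lt_iff₀ hη] at h3
          linarith
        have := min_le_right 1 (δ / Sg Z g)
        have := Finset.sum_nonneg fun i (_ : i ∈ (Finset.univ : Finset (Fin d))) => hnn i
        linarith
    · have := Finset.sum_nonneg fun i (_ : i ∈ (Finset.univ : Finset (Fin d))) => hnn i
      linarith
  -- A lower bound
  have hAle : (1 - h) / (d + 1) - (u - h) ≤ A := by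
    have e1 := sym_exact (w := w) (d := d) hZ δ
    have e2 : Ex (piw (ι := Fin d) w) (fun g => Ex w (fun a =>
        if δ < Sg Z g + Z a then (1 : ℝ) else 0)) = 1 - h := by
      refine Eq.trans ?_ (congrArg (· - h) (Ex_const hP 1))
      rw [hh, ← Ex_sub]
      congr 1
      funext g
      refine Eq.trans ?_ (congrArg (· - _) (Ex_const hw 1))
      rw [← Ex_sub]
      congr 1
      funext a
      by_cases h2 : δ < Sg Z g + Z a
      · simp [h2, not_le.mpr h2]
      · simp [h2, not_lt.mp h2]
    rw [e2] at e1
    have e3 : (1 - h) / ((d : ℝ) + 1) = Ex (piw (ι := Fin d) w) (fun g => Ex w (fun a =>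
        if δ < Sg Z g + Z a then Z a / (Sg Z g + Z a) else 0)) := by
      rw [← e1]; field_simp
    have e4 : u = Ex (piw (ι := Fin d) w) (fun g => Ex w (fun _ =>
        if Sg Z g ≤ δ then (1 : ℝ) else 0)) := by
      simp only [Ex_const hw]
      rfl
    rw [e3, e4, hh, ← Ex_sub, ← Ex_sub]
    apply Ex_mono hP
    intro g
    rw [← Ex_sub, ← Ex_sub]
    apply Ex_mono hw
    intro a
    have hS := Sg_pos hd hZ g
    have ha := hZ a
    have hr0 : 0 ≤ Z a / (Sg Z g + Z a) := by positivity
    have hr1 : Z a / (Sg Z g + Z a) ≤ 1 := by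
      rw [div_le_one (by positivity)]; linarith
    by_cases h2 : δ < Sg Z g
    · have h3 : δ < Sg Z g + Z a := by linarith
      simp [h2, h3, not_le.mpr h2, not_le.mpr h3]
    · by_cases h3 : δ < Sg Z g + Z a
      · simp [h2, h3, not_lt.mp h2, not_le.mpr h3]
        linarith
      · simp [h2, h3, not_lt.mp h2, not_lt.mp h3]
  have hψs := hψ s (hs'0.trans hss)
  have hexp := exp_add_mono (mul_nonneg hc0 hu0) (mul_le_mul_of_nonneg_left hus hc0)
  have hpow := pow_diff hs'0 hss hs1 (d + 1)
  push_cast at hpow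
  have hpow2 : s ^ (d + 1) ≤ h + (d + 1) * ε := by nlinarith
  have hk : 0 ≤ c * (d / (d + 1)) := by positivity
  have h5 := mul_le_mul_of_nonneg_left hpow2 hk
  have h5' : c * (d / (d + 1)) * (h + (d + 1) * ε) = c * (d / (d + 1)) * h + c * d * ε := by
    field_simp
  have h6 := mul_le_mul_of_nonneg_left hMle hc0
  have h7 := mul_le_mul_of_nonneg_left hAle hc0
  have h8 : c * ((1 - h) / (d + 1) - (u - h)) =
      c / (d + 1) + c * (d / (d + 1)) * h - c * u := by
    field_simp
    ring
  have h9 : c * (A - M - D / δ) = c * A - c * M - c * (D / δ) := by ring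
  rw [h9] at h1
  linarith
end onestep
end

noncomputable section

/-! ### Labelled random trees -/

/-- Depth `k` labelled trees. -/
def LTr (n d : ℕ) : ℕ → Type
  | 0 => Unit
  | k + 1 => Fin n → Option (Fin d → LTr n d k)

instance instLT (n d : ℕ) : ∀ k, Fintype (LTr n d k)
  | 0 => inferInstanceAs (Fintype Unit)
  | k + 1 => by
    have := instLT n d k
    exact inferInstanceAs (Fintype (Fin n → Option (Fin d → LTr n d k)))

/-- law of the random tree -/
def wt (n d : ℕ) (p : ℝ) : ∀ k, LTr n d k → ℝ
  | 0 => fun _ => 1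
  | k + 1 => stepw n d p (wt n d p k)

/-- the energy of a tree -/
def xv (n d : ℕ) : ∀ k, LTr n d k → ℝ
  | 0 => fun _ => 1
  | k + 1 => Yst (xv n d k)

def trunc (n d : ℕ) : ∀ k, LTr n d (k + 1) → LTr n d k
  | 0 => fun _ => ()
  | k + 1 => fun T v => (T v).map (fun g i => trunc n d k (g i))

section
variable {n d : ℕ}

lemma wt_prob {p : ℝ} (hp0 : 0 ≤ p) (hp1 : p ≤ 1) : ∀ k, IsProb (wt n d p k)
  | 0 => ⟨fun _ => zero_le_one, by
      change ∑ a : Unit, (1 : ℝ) = 1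
      simp⟩
  | k + 1 => stepw_prob hp0 hp1 (wt_prob hp0 hp1 k)

lemma xv_pos (hd : 0 < d) : ∀ k (T : LTr n d k), 0 < xv n d k T
  | 0, _ => one_pos
  | k + 1, T => Yst_pos hd (xv_pos hd k) T

lemma xv_le_one (hd : 0 < d) : ∀ k (T : LTr n d k), xv n d k T ≤ 1
  | 0, _ => le_rfl
  | k + 1, T => Yst_le_one hd (xv_pos hd k) T

lemma oinv_mono {α β : Type} {Z : α → ℝ} {Z' : β → ℝ} (hd : 0 < d) (hZ : ∀ a, 0 < Z a) 
    (φ : α → β) (h : ∀ a, Z a ≤ Z' (φ a)) (o : Option (Fin d → α)) :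
    oinv Z' (o.map (fun g i => φ (g i))) ≤ oinv Z o := by
  cases o with
  | none => exact le_rfl
  | some g =>
    have : Nonempty (Fin d) := ⟨⟨0, hd⟩⟩
    have h1 : 0 < Sg Z g := Finset.sum_pos (fun i _ => hZ _) Finset.univ_nonempty
    change 1 / Sg Z' (fun i => φ (g i)) ≤ 1 / Sg Z g
    exact one_div_le_one_div_of_le h1 (Finset.sum_le_sum fun i _ => h _)

lemma xv_trunc (hd : 0 < d) : ∀ k (T : LTr n d (k + 1)), xv n d (k + 1) T ≤ xv n d k (trunc n d k T)
  | 0, T => xv_le_one hd 1 T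
  | k + 1, T => by
    have ih := xv_trunc hd k
    change Yst (xv n d (k + 1)) T ≤ Yst (xv n d k) (fun v => (T v).map (fun g i => trunc n d k (g i)))
    unfold Yst
    have h0 : 0 ≤ ∑ v, oinv (xv n d k) ((T v).map (fun g i => trunc n d k (g i))) :=
      Finset.sum_nonneg fun v _ => oinv_nonneg hd (xv_pos hd k) _
    apply one_div_le_one_div_of_le (by positivity)
    gcongr with v
    exact oinv_mono hd (xv_pos hd (k + 1)) (trunc n d k) ih (T v)

lemma pi_law {α β ι : Type} [Fintype α] [Fintype β] [Fintype ι] [DecidableEq ι] {w : α → ℝ} {w' : β → ℝ}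
    (φ : α → β) (h : ∀ f : β → ℝ, Ex w (fun a => f (φ a)) = Ex w' f) (f : (ι → β) → ℝ) :
    Ex (piw (ι := ι) w) (fun q => f (fun i => φ (q i))) = Ex (piw (ι := ι) w') f := by
  have h1 : ∀ g : ι → β, piw w' g =
      Ex (piw (ι := ι) w) (fun q => ∏ i, if φ (q i) = g i then (1 : ℝ) else 0) := by
    intro g
    rw [Ex_pi_prod w (fun i a => if φ a = g i then (1 : ℝ) else 0)]
    unfold piw
    refine Finset.prod_congr rfl fun i _ => ?_
    rw [h (fun b => if b = g i then (1 : ℝ) else 0)]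
    simp [Ex]
  have h2 : Ex (piw (ι := ι) w') f = ∑ g : ι → β, Ex (piw (ι := ι) w)
      (fun q => (∏ i, if φ (q i) = g i then (1 : ℝ) else 0) * f g) := by
    rw [Ex]
    refine Finset.sum_congr rfl fun g _ => ?_
    rw [Ex_mul_right, ← h1]
  rw [h2, ← Ex_sum]
  congr 1
  funext q
  rw [Finset.sum_eq_single (fun i => φ (q i))]
  · simp
  · intro g _ hg
    have : ∃ i, φ (q i) ≠ g i := by
      by_contra hc
      push Not at hc
      exact hg (funext fun i => (hc i).symm)
    obtain ⟨i, hi⟩ := this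
    rw [Finset.prod_eq_zero (Finset.mem_univ i) (by simp [hi]), zero_mul]
  · simp

lemma trunc_law {p : ℝ} (hp0 : 0 ≤ p) (hp1 : p ≤ 1) : ∀ k (f : LTr n d k → ℝ),
    Ex (wt n d p (k + 1)) (fun T => f (trunc n d k T)) = Ex (wt n d p k) f
  | 0, f => by
    change Ex (wt n d p 1) (fun T => f ()) = _
    rw [Ex_const (wt_prob hp0 hp1 1)]
    have := Ex_const (wt_prob (n := n) (d := d) hp0 hp1 0) (f ())
    exact this.symm
  | k + 1, f => by
    have ih := trunc_law hp0 hp1 k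
    have h1 : ∀ f : (Fin d → LTr n d k) → ℝ, Ex (piw (wt n d p (k + 1)))
        (fun g => f (fun i => trunc n d k (g i))) = Ex (piw (wt n d p k)) f :=
      fun f => pi_law (trunc n d k) ih f
    have h2 : ∀ f : Option (Fin d → LTr n d k) → ℝ,
        Ex (optw p (piw (wt n d p (k + 1)))) (fun o => f (o.map (fun g i => trunc n d k (g i)))) =
        Ex (optw p (piw (wt n d p k))) f := by
      intro f
      rw [Ex_opt, Ex_opt, ← h1 (fun g => f (some g))]
      rfl
    exact pi_law (ι := Fin n) _ h2 f

lemma exists_scale {α : Type} [Fintype α] {w : α → ℝ} (hw : IsProb w) (Z : α → ℝ) {η : ℝ}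
    (hη : 0 < η) (hη1 : η ≤ 1) {J : ℕ} (hJ : 0 < J) :
    ∃ j < J, Ex w (fun a => if η * η ^ (2 * j + 1) < Z a ∧ Z a ≤ η ^ (2 * j + 1) / η
      then (1 : ℝ) else 0) ≤ 1 / J := by
  by_contra hcon
  push Not at hcon
  have h1 : ∑ j ∈ Finset.range J, (1 : ℝ) / J < ∑ j ∈ Finset.range J, Ex w (fun a =>
      if η * η ^ (2 * j + 1) < Z a ∧ Z a ≤ η ^ (2 * j + 1) / η then (1 : ℝ) else 0) :=
    Finset.sum_lt_sum_of_nonempty (by simpa using hJ.ne')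
      fun j hj => hcon j (Finset.mem_range.mp hj)
  have h2 : ∑ j ∈ Finset.range J, (1 : ℝ) / J = 1 := by
    have : (J : ℝ) ≠ 0 := by positivity
    simp [this]
  rw [h2, ← Ex_sum] at h1
  have h3 := Ex_const hw 1
  have h4 : Ex w (fun a => ∑ j ∈ Finset.range J,
      if η * η ^ (2 * j + 1) < Z a ∧ Z a ≤ η ^ (2 * j + 1) / η then (1 : ℝ) else 0) ≤
      Ex w (fun _ => 1) := by
    apply Ex_mono hw
    intro a
    rw [Finset.sum_boole]
    have : ((Finset.range J).filter (fun j =>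
      η * η ^ (2 * j + 1) < Z a ∧ Z a ≤ η ^ (2 * j + 1) / η)).card ≤ 1 := by
      rw [Finset.card_le_one]
      have key : ∀ i j : ℕ, η * η ^ (2 * i + 1) < Z a → Z a ≤ η ^ (2 * j + 1) / η → ¬ i < j := by
        intro i j h5 h6 hij
        have e1 : η * η ^ (2 * i + 1) = η ^ (2 * i + 2) := by ring
        have e2 : η ^ (2 * j + 1) / η = η ^ (2 * j) := by field_simp; ring
        have : η ^ (2 * j) ≤ η ^ (2 * i + 2) := pow_le_pow_of_le_one hη.le hη1 (by omega)
        rw [e1] at h5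
        rw [e2] at h6
        linarith
      intro i hi j hj
      simp only [Finset.mem_filter] at hi hj
      have a1 := key i j hi.2.1 hj.2.2
      have a2 := key j i hj.2.1 hi.2.2
      omega
    exact_mod_cast this
  linarith

lemma A_anti {p : ℝ} (hd : 0 < d) (hp0 : 0 ≤ p) (hp1 : p ≤ 1) (k : ℕ) :
    Ex (wt n d p (k + 1)) (xv n d (k + 1)) ≤ Ex (wt n d p k) (xv n d k) := by
  rw [← trunc_law hp0 hp1 k]
  exact Ex_mono (wt_prob hp0 hp1 (k + 1)) fun T => xv_trunc hd k T

lemma A_small (d : ℕ) (hd : 0 < d) {c : ℝ} (hc0 : 0 < c)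
    (hψ : ∀ s : ℝ, 0 ≤ s →
      Real.exp (-(c * s ^ d)) + c * s ^ d - c * (d / (d + 1)) * s ^ (d + 1) ≤ 1)
    {ε : ℝ} (hε : 0 < ε) :
    ∃ K : ℕ, ∀ n : ℕ, 0 < n → c ≤ n →
      Ex (wt n d (c / n) K) (xv n d K) ≤ 1 - c / (d + 1) + ε := by
  set η : ℝ := min (1 / (d + 1)) (ε / (4 * (1 + c))) with hη
  have hη0 : 0 < η := lt_min (by positivity) (by positivity)
  have hη1 : η * (d + 1) ≤ 1 := by
    have := min_le_left (1 / ((d : ℝ) + 1)) (ε / (4 * (1 + c)))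
    rw [← hη, le_div_iff₀ (by positivity)] at this
    exact this
  have hη2 : (1 + c) * η ≤ ε / 4 := by
    have := min_le_right (1 / ((d : ℝ) + 1)) (ε / (4 * (1 + c)))
    rw [← hη, le_div_iff₀ (by positivity)] at this
    linarith
  have hηle : η ≤ 1 := by
    have : (0 : ℝ) ≤ d := by positivity
    nlinarith
  obtain ⟨J, hJ⟩ := exists_nat_gt (8 * c * d / ε)
  have hJ0 : 0 < J := by
    have : (0 : ℝ) < J := lt_of_le_of_lt (by positivity) hJ
    exact_mod_cast this
  obtain ⟨K, hK⟩ := exists_nat_gt (4 * c / (η ^ (2 * J) * ε))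
  have hK0 : 0 < K := by
    have : (0 : ℝ) < K := lt_of_le_of_lt (by positivity) hK
    exact_mod_cast this
  refine ⟨K, fun n hn hcn => ?_⟩
  have hn' : (0 : ℝ) < n := by exact_mod_cast hn
  have hp0 : 0 ≤ c / n := by positivity
  have hp1 : c / n ≤ 1 := by rw [div_le_one hn']; exact hcn
  set A : ℕ → ℝ := fun k => Ex (wt n d (c / n) k) (xv n d k) with hA
  have hanti : Antitone A := antitone_nat_of_succ_le fun k => A_anti hd hp0 hp1 k
  have hA0 : A 0 = 1 := Ex_const (wt_prob hp0 hp1 0) 1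
  have hAn : ∀ k, 0 ≤ A k := fun k =>
    Ex_nonneg (wt_prob hp0 hp1 k) fun T => (xv_pos hd k T).le
  have hex : ∃ k < K, A k - A (k + 1) ≤ 1 / K := by
    by_contra hcon
    push Not at hcon
    have h1 : ∑ j ∈ Finset.range K, (1 : ℝ) / K < ∑ j ∈ Finset.range K, (A j - A (j + 1)) :=
      Finset.sum_lt_sum_of_nonempty (by simpa using hK0.ne')
        fun j hj => hcon j (Finset.mem_range.mp hj)
    rw [Finset.sum_range_sub'] at h1
    have h2 : ∑ j ∈ Finset.range K, (1 : ℝ) / K = 1 := by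
      have : (K : ℝ) ≠ 0 := by positivity
      simp [this]
    have := hAn K
    linarith
  obtain ⟨k, hk, hkA⟩ := hex
  obtain ⟨j, hj, hjP⟩ := exists_scale (wt_prob hp0 hp1 k) (xv n d k) hη0 hηle hJ0
  have hone := onestep2 (n := n) (d := d) hp0 hp1 (mul_div_cancel₀ c hn'.ne') hd (wt_prob hp0 hp1 k)
    (xv_pos hd k) (trunc n d k) (trunc_law hp0 hp1 k) (xv_trunc hd k)
    (pow_pos hη0 (2 * j + 1)) hη0 hη1 hψ
  set P := Ex (wt n d (c / n) k) (fun a => if η * η ^ (2 * j + 1) < xv n d k a ∧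
    xv n d k a ≤ η ^ (2 * j + 1) / η then (1 : ℝ) else 0) with hP
  change A (k + 1) ≤ 1 - c / (d + 1) + η ^ (2 * j + 1) + c * η + 2 * c * d * P +
    c * ((A k - A (k + 1)) / η ^ (2 * j + 1)) at hone
  have hδ : η ^ (2 * j + 1) ≤ η := by
    calc η ^ (2 * j + 1) ≤ η ^ 1 := pow_le_pow_of_le_one hη0.le hηle (by omega)
      _ = η := pow_one _
  have hδ2 : η ^ (2 * J) ≤ η ^ (2 * j + 1) := pow_le_pow_of_le_one hη0.le hηle (by omega)
  have hJ' : (0 : ℝ) < J := by exact_mod_cast hJ0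
  have hK' : (0 : ℝ) < K := by exact_mod_cast hK0
  have t1 : 2 * c * d * P ≤ ε / 4 := by
    calc 2 * c * d * P ≤ 2 * c * d * (1 / J) := by gcongr
      _ ≤ ε / 4 := by
        rw [div_lt_iff₀ hε] at hJ
        rw [mul_one_div, div_le_iff₀ hJ']
        linarith
  have t2 : c * ((A k - A (k + 1)) / η ^ (2 * j + 1)) ≤ ε / 4 := by
    have hpos := pow_pos hη0 (2 * J)
    calc c * ((A k - A (k + 1)) / η ^ (2 * j + 1)) ≤ c * ((1 / K) / η ^ (2 * J)) := by gcongr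
      _ ≤ ε / 4 := by
        rw [div_lt_iff₀ (by positivity)] at hK
        rw [div_div, mul_one_div, div_le_iff₀ (by positivity)]
        linarith
  have := hanti (show k + 1 ≤ K from hk)
  linarith

end
end

noncomputable section

/-- probability of an event -/
def Pr {α : Type} [Fintype α] (w : α → ℝ) (E : α → Prop) : ℝ :=
  Ex w (fun a => if E a then 1 else 0)

section prb
variable {α : Type} [Fintype α] {w : α → ℝ} {n d : ℕ}

lemma Pr_mono (hw : IsProb w) {E E' : α → Prop} (h : ∀ a, E a → E' a) : Pr w E ≤ Pr w E' := by
  apply Ex_mono hw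
  intro a
  by_cases h1 : E a
  · simp [h1, h a h1]
  · simp only [h1, if_false]
    split_ifs <;> norm_num

lemma Pr_nonneg (hw : IsProb w) (E : α → Prop) : 0 ≤ Pr w E :=
  Ex_nonneg hw fun a => by split_ifs <;> norm_num

lemma Pr_le_one (hw : IsProb w) (E : α → Prop) : Pr w E ≤ 1 := by
  refine le_trans ?_ (Ex_const hw 1).le
  exact Ex_mono hw fun g => by split_ifs <;> norm_num

lemma Pr_false (w : α → ℝ) : Pr w (fun _ => False) = 0 := by simp [Pr, Ex]

lemma Pr_true (hw : IsProb w) : Pr w (fun _ => True) = 1 := by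
  simp [Pr, Ex_const hw]

lemma Pr_or (hw : IsProb w) (E E' : α → Prop) : Pr w (fun a => E a ∨ E' a) ≤ Pr w E + Pr w E' := by
  unfold Pr
  rw [← Ex_add]
  apply Ex_mono hw
  intro a
  by_cases h1 : E a <;> by_cases h2 : E' a <;> simp [h1, h2]

lemma Pr_exists {κ : Type} [Fintype κ] (hw : IsProb w) (E : κ → α → Prop) {q : ℝ}
    (hq : ∀ k, Pr w (E k) ≤ q) : Pr w (fun a => ∃ k, E k a) ≤ Fintype.card κ * q := by
  have h1 : Pr w (fun a => ∃ k, E k a) ≤ ∑ k, Pr w (E k) := by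
    unfold Pr
    rw [← Ex_sum]
    apply Ex_mono hw
    intro a
    have hnn : ∀ k ∈ (Finset.univ : Finset κ), (0 : ℝ) ≤ if E k a then (1 : ℝ) else 0 :=
      fun k _ => by split_ifs <;> norm_num
    split_ifs with h
    · obtain ⟨k, hk⟩ := h
      have := Finset.single_le_sum hnn (Finset.mem_univ k)
      simpa [hk] using this
    · exact Finset.sum_nonneg hnn
  refine h1.trans ((Finset.sum_le_sum fun k _ => hq k).trans ?_)
  simp

/-- event that position `o` carries a child satisfying `Q` -/
def hasQ (Q : (Fin d → α) → Prop) : Option (Fin d → α) → Prop := fun o => ∃ g, o = some g ∧ Q g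

lemma Pr_hasQ (p : ℝ) (w : α → ℝ) (Q : (Fin d → α) → Prop) :
    Pr (optw p (piw (ι := Fin d) w)) (hasQ Q) = p * Pr (piw (ι := Fin d) w) Q := by
  unfold Pr
  rw [Ex_opt]
  simp [hasQ]

lemma Pr_step_one {p : ℝ} (hp0 : 0 ≤ p) (hp1 : p ≤ 1) (hw : IsProb w) (v : Fin n)
    (Q : (Fin d → α) → Prop) :
    Pr (stepw n d p w) (fun T => hasQ Q (T v)) = p * Pr (piw (ι := Fin d) w) Q := by
  rw [← Pr_hasQ]
  exact Ex_pi_single (optw_prob hp0 hp1 (piw_prob hw)) v (fun o => if hasQ Q o then (1 : ℝ) else 0)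

lemma Pr_step_two {p : ℝ} (hp0 : 0 ≤ p) (hp1 : p ≤ 1) (hw : IsProb w) (v v' : Fin n)
    (Q Q' : (Fin d → α) → Prop) :
    Pr (stepw n d p w) (fun T => v ≠ v' ∧ hasQ Q (T v) ∧ hasQ Q' (T v')) ≤
      p * Pr (piw (ι := Fin d) w) Q * (p * Pr (piw (ι := Fin d) w) Q') := by
  have hP := piw_prob (ι := Fin d) hw
  by_cases h : v = v'
  · have : Pr (stepw n d p w) (fun T => v ≠ v' ∧ hasQ Q (T v) ∧ hasQ Q' (T v')) = 0 := by
      simp [Pr, h, Ex_zero]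
    rw [this]
    exact mul_nonneg (mul_nonneg hp0 (Pr_nonneg hP _)) (mul_nonneg hp0 (Pr_nonneg hP _))
  · rw [← Pr_hasQ, ← Pr_hasQ]
    have := Ex_pi_two (optw_prob hp0 hp1 hP) h (fun o => if hasQ Q o then (1 : ℝ) else 0)
      (fun o => if hasQ Q' o then (1 : ℝ) else 0)
    refine le_of_eq (Eq.trans ?_ this)
    unfold Pr stepw
    congr 1
    funext T
    by_cases h1 : hasQ Q (T v) <;> by_cases h2 : hasQ Q' (T v') <;> simp [h, h1, h2]

lemma Pr_pi_one (hw : IsProb w) (i : Fin d) (Q : α → Prop) :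
    Pr (piw (ι := Fin d) w) (fun g => Q (g i)) = Pr w Q :=
  Ex_pi_single hw i (fun o => if Q o then (1 : ℝ) else 0)

lemma Pr_pi_two (hw : IsProb w) (i j : Fin d) (Q Q' : α → Prop) :
    Pr (piw (ι := Fin d) w) (fun g => i ≠ j ∧ Q (g i) ∧ Q' (g j)) ≤ Pr w Q * Pr w Q' := by
  by_cases h : i = j
  · have : Pr (piw (ι := Fin d) w) (fun g => i ≠ j ∧ Q (g i) ∧ Q' (g j)) = 0 := by
      simp [Pr, h, Ex_zero]
    rw [this]
    exact mul_nonneg (Pr_nonneg hw _) (Pr_nonneg hw _)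
  · have := Ex_pi_two hw h (fun o => if Q o then (1 : ℝ) else 0)
      (fun o => if Q' o then (1 : ℝ) else 0)
    refine le_of_eq (Eq.trans ?_ this)
    unfold Pr
    congr 1
    funext T
    by_cases h1 : Q (T i) <;> by_cases h2 : Q' (T j) <;> simp [h, h1, h2]

end prb

/-- labels used by the tree -/
def Vert (n d : ℕ) : ∀ k, LTr n d k → Finset (Fin n)
  | 0 => fun _ => ∅
  | k + 1 => fun T => Finset.univ.filter (fun x =>
      ∃ v g, T v = some g ∧ (x = v ∨ ∃ i, x ∈ Vert n d k (g i)))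

/-- generic trees: no label is used twice -/
def IG (n d : ℕ) : ∀ k, LTr n d k → Prop
  | 0 => fun _ => True
  | k + 1 => fun T =>
      (∀ v g, T v = some g → ∀ i, IG n d k (g i)) ∧
      (∀ v g u g', T v = some g → T u = some g' → ∀ i, u ∉ Vert n d k (g i)) ∧
      (∀ v g u g', T v = some g → T u = some g' → ∀ i j, (v ≠ u ∨ i ≠ j) →
        Disjoint (Vert n d k (g i)) (Vert n d k (g' j)))

lemma mem_Vert_succ {n d k : ℕ} (T : Fin n → Option (Fin d → LTr n d k)) (x : Fin n) :
    x ∈ Vert n d (k + 1) T ↔ ∃ v g, T v = some g ∧ (x = v ∨ ∃ i, x ∈ Vert n d k (g i)) := by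
  simp [Vert]

lemma bad_bound (d : ℕ) {c : ℝ} (hc0 : 0 < c) : ∀ k : ℕ, ∃ C B : ℝ, 0 ≤ C ∧ 0 ≤ B ∧
    ∀ n : ℕ, 0 < n → c ≤ n →
      (∀ x, Pr (wt n d (c / n) k) (fun T => x ∈ Vert n d k T) ≤ C / n) ∧
      Pr (wt n d (c / n) k) (fun T => ¬ IG n d k T) ≤ B / n := by
  intro k
  induction k with
  | zero =>
    refine ⟨0, 0, le_rfl, le_rfl, fun n hn hcn => ⟨fun x => ?_, ?_⟩⟩
    · simp [Vert, Pr, Ex_zero]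
    · simp [IG, Pr, Ex_zero]
  | succ k ih =>
    obtain ⟨C, B, hC, hB, ih⟩ := ih
    refine ⟨c + c * d * C, c * d * B + c * d * C + c ^ 2 * d * C + c * d ^ 2 * C ^ 2
      + c ^ 2 * d ^ 2 * C ^ 2, by positivity, by positivity, fun n hn hcn => ?_⟩
    obtain ⟨ihV, ihG⟩ := ih n hn hcn
    have hn' : (0 : ℝ) < n := by exact_mod_cast hn
    have hp0 : 0 ≤ c / n := by positivity
    have hp1 : c / n ≤ 1 := by rw [div_le_one hn']; exact hcn
    have hw := wt_prob (n := n) (d := d) hp0 hp1 k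
    have hW := stepw_prob (n := n) (d := d) hp0 hp1 hw
    have hP := piw_prob (ι := Fin d) hw
    have hV1 : ∀ (v x : Fin n) (i : Fin d), Pr (stepw n d (c / n) (wt n d (c / n) k))
        (fun T => hasQ (fun g => x ∈ Vert n d k (g i)) (T v)) ≤ c / n * (C / n) := by
      intro v x i
      rw [Pr_step_one hp0 hp1 hw, Pr_pi_one hw i (fun a => x ∈ Vert n d k a)]
      gcongr
      exact ihV x
    constructor
    · intro x
      have h1 : Pr (wt n d (c / n) (k + 1)) (fun T => x ∈ Vert n d (k + 1) T) ≤
          Pr (stepw n d (c / n) (wt n d (c / n) k)) (fun T => hasQ (fun _ => True) (T x) ∨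
            ∃ q : Fin n × Fin d, hasQ (fun g => x ∈ Vert n d k (g q.2)) (T q.1)) := by
        apply Pr_mono hW
        intro T hT
        rw [mem_Vert_succ] at hT
        obtain ⟨v, g, hg, rfl | ⟨i, hi⟩⟩ := hT
        · exact Or.inl ⟨g, hg, trivial⟩
        · exact Or.inr ⟨(v, i), g, hg, hi⟩
      have h2 := Pr_or hW (fun T => hasQ (fun _ => True) (T x))
        (fun T => ∃ q : Fin n × Fin d, hasQ (fun g => x ∈ Vert n d k (g q.2)) (T q.1))
      have h3 := Pr_exists hW (fun (q : Fin n × Fin d) T =>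
        hasQ (fun g => x ∈ Vert n d k (g q.2)) (T q.1)) (fun q => hV1 q.1 x q.2)
      rw [Pr_step_one hp0 hp1 hw, Pr_true hP] at h2
      simp only [Fintype.card_prod, Fintype.card_fin, Nat.cast_mul] at h3
      have e : (n : ℝ) * d * (c / n * (C / n)) + c / n * 1 = (c + c * d * C) / n := by
        field_simp
        ring
      linarith
    · set W := stepw n d (c / n) (wt n d (c / n) k) with hWd
      let E1 : (Fin n → Option (Fin d → LTr n d k)) → Prop := fun T =>
        ∃ q : Fin n × Fin d, hasQ (fun g => ¬ IG n d k (g q.2)) (T q.1)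
      let E2 : (Fin n → Option (Fin d → LTr n d k)) → Prop := fun T =>
        ∃ q : Fin n × Fin d, hasQ (fun g => q.1 ∈ Vert n d k (g q.2)) (T q.1)
      let E3 : (Fin n → Option (Fin d → LTr n d k)) → Prop := fun T =>
        ∃ q : (Fin n × Fin n) × Fin d, q.1.1 ≠ q.1.2 ∧
          hasQ (fun g => q.1.2 ∈ Vert n d k (g q.2)) (T q.1.1) ∧ hasQ (fun _ => True) (T q.1.2)
      let E4 : (Fin n → Option (Fin d → LTr n d k)) → Prop := fun T =>
        ∃ q : (Fin n × Fin n) × (Fin d × Fin d),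
          hasQ (fun g => q.2.1 ≠ q.2.2 ∧ q.1.2 ∈ Vert n d k (g q.2.1) ∧
            q.1.2 ∈ Vert n d k (g q.2.2)) (T q.1.1)
      let E5 : (Fin n → Option (Fin d → LTr n d k)) → Prop := fun T =>
        ∃ q : ((Fin n × Fin n) × Fin n) × (Fin d × Fin d), q.1.1.1 ≠ q.1.1.2 ∧
          hasQ (fun g => q.1.2 ∈ Vert n d k (g q.2.1)) (T q.1.1.1) ∧
          hasQ (fun g => q.1.2 ∈ Vert n d k (g q.2.2)) (T q.1.1.2)
      have hsub : Pr (wt n d (c / n) (k + 1)) (fun T => ¬ IG n d (k + 1) T) ≤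
          Pr W (fun T => ((((E1 T ∨ E2 T) ∨ E3 T) ∨ E4 T) ∨ E5 T)) := by
        apply Pr_mono hW
        intro T hT
        by_contra hcon
        push Not at hcon
        obtain ⟨⟨⟨⟨n1, n2⟩, n3⟩, n4⟩, n5⟩ := hcon
        apply hT
        refine ⟨?_, ?_, ?_⟩
        · intro v g hg i
          by_contra h
          exact n1 ⟨(v, i), g, hg, h⟩
        · intro v g u g' hg hg' i h
          by_cases hvu : v = u
          · subst hvu
            exact n2 ⟨(v, i), g, hg, h⟩
          · exact n3 ⟨((v, u), i), hvu, ⟨g, hg, h⟩, ⟨g', hg', trivial⟩⟩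
        · intro v g u g' hg hg' i j hne
          rw [Finset.disjoint_left]
          intro x hx hx'
          by_cases hvu : v = u
          · subst hvu
            rw [hg] at hg'
            obtain rfl := Option.some.inj hg'
            exact n4 ⟨((v, x), (i, j)), g, hg, by simpa using hne, hx, hx'⟩
          · exact n5 ⟨(((v, u), x), (i, j)), hvu, ⟨g, hg, hx⟩, ⟨g', hg', hx'⟩⟩
      have o1 := Pr_or hW (fun T => ((E1 T ∨ E2 T) ∨ E3 T) ∨ E4 T) E5
      have o2 := Pr_or hW (fun T => (E1 T ∨ E2 T) ∨ E3 T) E4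
      have o3 := Pr_or hW (fun T => E1 T ∨ E2 T) E3
      have o4 := Pr_or hW E1 E2
      have b1 : Pr W E1 ≤ _ := Pr_exists hW (q := c / n * (B / n)) _ (fun q => by
        rw [Pr_step_one hp0 hp1 hw, Pr_pi_one hw q.2 (fun a => ¬ IG n d k a)]
        gcongr)
      have b2 : Pr W E2 ≤ _ := Pr_exists hW _ (fun q => hV1 q.1 q.1 q.2)
      have b3 : Pr W E3 ≤ _ := Pr_exists hW (q := c / n * (C / n) * (c / n * 1)) _ (fun q => by
        refine (Pr_step_two hp0 hp1 hw _ _ _ _).trans ?_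
        rw [Pr_pi_one hw q.2 (fun a => q.1.2 ∈ Vert n d k a), Pr_true hP]
        gcongr
        exact ihV _)
      have b4 : Pr W E4 ≤ _ := Pr_exists hW (q := c / n * (C / n * (C / n))) _ (fun q => by
        rw [Pr_step_one hp0 hp1 hw]
        gcongr
        refine (Pr_pi_two hw q.2.1 q.2.2 (fun a => q.1.2 ∈ Vert n d k a)
          (fun a => q.1.2 ∈ Vert n d k a)).trans ?_
        have := Pr_nonneg hw (fun a => q.1.2 ∈ Vert n d k a)
        have := ihV q.1.2
        gcongr)
      have b5 : Pr W E5 ≤ _ := Pr_exists hW (q := c / n * (C / n) * (c / n * (C / n))) _ (fun q => by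
        refine (Pr_step_two hp0 hp1 hw _ _ _ _).trans ?_
        rw [Pr_pi_one hw q.2.1 (fun a => q.1.2 ∈ Vert n d k a),
          Pr_pi_one hw q.2.2 (fun a => q.1.2 ∈ Vert n d k a)]
        have := Pr_nonneg hw (fun a => q.1.2 ∈ Vert n d k a)
        have := ihV q.1.2
        gcongr)
      simp only [Fintype.card_prod, Fintype.card_fin, Nat.cast_mul] at b1 b2 b3 b4 b5
      have e : (n : ℝ) * d * (c / n * (B / n)) + n * d * (c / n * (C / n)) +
          n * n * d * (c / n * (C / n) * (c / n * 1)) +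
          n * n * (d * d) * (c / n * (C / n * (C / n))) +
          n * n * n * (d * d) * (c / n * (C / n) * (c / n * (C / n))) =
          (c * d * B + c * d * C + c ^ 2 * d * C + c * d ^ 2 * C ^ 2
            + c ^ 2 * d ^ 2 * C ^ 2) / n := by
        field_simp
      linarith

/-- trees which are generic and avoid the vertices in `A` -/
def Good (n d k : ℕ) (A : Finset (Fin n)) (T : LTr n d k) : Prop :=
  IG n d k T ∧ Disjoint (Vert n d k T) A

lemma notGood_bound (d : ℕ) {c : ℝ} (hc0 : 0 < c) (k : ℕ) : ∃ C : ℝ, 0 ≤ C ∧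
    ∀ n : ℕ, 0 < n → c ≤ n → ∀ e : Fin d → Fin n,
      Pr (wt n d (c / n) k) (fun T => ¬ Good n d k (Finset.univ.image e) T) ≤ C / n := by
  obtain ⟨C, B, hC, hB, h⟩ := bad_bound d hc0 k
  refine ⟨B + d * C, by positivity, fun n hn hcn e => ?_⟩
  obtain ⟨hV, hG⟩ := h n hn hcn
  have hn' : (0 : ℝ) < n := by exact_mod_cast hn
  have hp0 : 0 ≤ c / n := by positivity
  have hp1 : c / n ≤ 1 := by rw [div_le_one hn']; exact hcn
  have hw := wt_prob (n := n) (d := d) hp0 hp1 k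
  have h1 : Pr (wt n d (c / n) k) (fun T => ¬ Good n d k (Finset.univ.image e) T) ≤
      Pr (wt n d (c / n) k) (fun T => ¬ IG n d k T ∨ ∃ i, e i ∈ Vert n d k T) := by
    apply Pr_mono hw
    intro T hT
    by_contra hcon
    push Not at hcon
    apply hT
    refine ⟨hcon.1, ?_⟩
    rw [Finset.disjoint_right]
    intro x hx
    simp only [Finset.mem_image, Finset.mem_univ, true_and] at hx
    obtain ⟨i, rfl⟩ := hx
    exact hcon.2 i
  have h2 := Pr_or hw (fun T => ¬ IG n d k T) (fun T => ∃ i, e i ∈ Vert n d k T)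
  have h3 := Pr_exists hw (fun (i : Fin d) T => e i ∈ Vert n d k T) (fun i => hV (e i))
  simp only [Fintype.card_fin] at h3
  have e' : B / n + d * (C / n) = (B + d * C) / n := by ring
  linarith

end

noncomputable section

/-! ### Coupling with the complex -/

section coupling
variable {n d : ℕ}

def Img (e : Fin d → Fin n) : Finset (Fin n) := Finset.univ.image e

lemma mem_Img (e : Fin d → Fin n) (x : Fin n) : x ∈ Img e ↔ ∃ i, e i = x := by
  simp [Img]

lemma Img_upd_sub (e : Fin d → Fin n) (i : Fin d) (v : Fin n) :
    Img (Function.update e i v) ⊆ insert v (Img e) := by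
  intro x hx
  rw [mem_Img] at hx
  obtain ⟨j, hj⟩ := hx
  rw [Finset.mem_insert, mem_Img]
  by_cases h : j = i
  · subst h; simp at hj; exact Or.inl hj.symm
  · rw [Function.update_of_ne h] at hj
    exact Or.inr ⟨j, hj⟩

lemma mem_Img_upd_self (e : Fin d → Fin n) (i : Fin d) (v : Fin n) :
    v ∈ Img (Function.update e i v) := by
  rw [mem_Img]; exact ⟨i, by simp⟩

lemma mem_Img_upd_ne (e : Fin d → Fin n) {i j : Fin d} (h : j ≠ i) (v : Fin n) :
    e j ∈ Img (Function.update e i v) := by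
  rw [mem_Img]; exact ⟨j, by simp [h]⟩

lemma not_mem_Img_upd {e : Fin d → Fin n} (he : Function.Injective e) (i : Fin d) {v : Fin n}
    (hv : v ∉ Img e) : e i ∉ Img (Function.update e i v) := by
  rw [mem_Img]
  rintro ⟨j, hj⟩
  by_cases h : j = i
  · subst h
    simp at hj
    exact hv ((mem_Img e v).mpr ⟨j, hj.symm⟩)
  · rw [Function.update_of_ne h] at hj
    exact h (he hj)

lemma upd_inj {e : Fin d → Fin n} (he : Function.Injective e) (i : Fin d) {v : Fin n}
    (hv : v ∉ Img e) : Function.Injective (Function.update e i v) := by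
  intro a b hab
  by_cases ha : a = i <;> by_cases hb : b = i
  · rw [ha, hb]
  · subst ha
    rw [Function.update_self, Function.update_of_ne hb] at hab
    exact absurd ((mem_Img e v).mpr ⟨b, hab.symm⟩) hv
  · subst hb
    rw [Function.update_self, Function.update_of_ne ha] at hab
    exact absurd ((mem_Img e v).mpr ⟨a, hab⟩) hv
  · rw [Function.update_of_ne ha, Function.update_of_ne hb] at hab
    exact he hab

lemma card_Img {e : Fin d → Fin n} (he : Function.Injective e) : (Img e).card = d := by
  rw [Img, Finset.card_image_of_injective _ he]
  simp

def Pc {α : Type} (f : α → (Fin d → Fin n) → Finset (Finset (Fin n))) (e : Fin d → Fin n) (v : Fin n) :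
    Option (Fin d → α) → Finset (Finset (Fin n))
  | none => ∅
  | some g => insert (insert v (Img e))
      (Finset.univ.biUnion fun i => f (g i) (Function.update e i v))

def Qc {α : Type} (f : α → (Fin d → Fin n) → Fin n → Finset (Finset (Fin n)))
    (e : Fin d → Fin n) (u v : Fin n) :
    Option (Fin d → α) → Finset (Finset (Fin n))
  | none => if v ∈ Img e ∨ v = u then ∅ else {insert v (Img e)}
  | some g => Finset.univ.biUnion fun i => f (g i) (Function.update e i v) (e i)

/-- faces required to be present -/
def PT (n d : ℕ) : ∀ k, LTr n d k → (Fin d → Fin n) → Finset (Finset (Fin n))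
  | 0 => fun _ _ => ∅
  | k + 1 => fun T e => Finset.univ.biUnion fun v => Pc (PT n d k) e v (T v)

/-- faces required to be absent -/
def QT (n d : ℕ) : ∀ k, LTr n d k → (Fin d → Fin n) → Fin n → Finset (Finset (Fin n))
  | 0 => fun _ _ _ => ∅
  | k + 1 => fun T e u => Finset.univ.biUnion fun v => Qc (QT n d k) e u v (T v)

/-- the exploration of the complex -/
def Bm (n d : ℕ) (F : Finset (Finset (Fin n))) : ∀ k, (Fin d → Fin n) → Fin n → LTr n d k
  | 0 => fun _ _ => ()
  | k + 1 => fun e u v =>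
    if v ∉ Img e ∧ v ≠ u ∧ insert v (Img e) ∈ F then
      some (fun i => Bm n d F k (Function.update e i v) (e i)) else none

lemma mem_PT_succ {k : ℕ} (T : Fin n → Option (Fin d → LTr n d k)) (e : Fin d → Fin n)
    (s : Finset (Fin n)) : s ∈ PT n d (k + 1) T e ↔ ∃ v g, T v = some g ∧
      (s = insert v (Img e) ∨ ∃ i, s ∈ PT n d k (g i) (Function.update e i v)) := by
  simp only [PT, Finset.mem_biUnion, Finset.mem_univ, true_and]
  refine exists_congr fun v => ?_
  cases h : T v with
  | none => simp [Pc]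
  | some g => simp [Pc]

lemma mem_QT_succ {k : ℕ} (T : Fin n → Option (Fin d → LTr n d k)) (e : Fin d → Fin n) (u : Fin n)
    (s : Finset (Fin n)) : s ∈ QT n d (k + 1) T e u ↔
      (∃ v, T v = none ∧ v ∉ Img e ∧ v ≠ u ∧ s = insert v (Img e)) ∨
      ∃ v g, T v = some g ∧ ∃ i, s ∈ QT n d k (g i) (Function.update e i v) (e i) := by
  simp only [QT, Finset.mem_biUnion, Finset.mem_univ, true_and]
  rw [← exists_or]
  refine exists_congr fun v => ?_
  cases h : T v with
  | none =>
    simp only [Qc]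
    by_cases h1 : v ∈ Img e ∨ v = u
    · simp only [h1, if_true]
      simp
      tauto
    · simp only [h1, if_false]
      simp
      tauto
  | some g => simp [Qc]

/-- inductive hypothesis on trees: generic, avoiding `e`. -/
lemma child_good {k : ℕ} {T : Fin n → Option (Fin d → LTr n d k)} {e : Fin d → Fin n}
    (hIG : IG n d (k + 1) T) (hdj : Disjoint (Vert n d (k + 1) T) (Img e))
    {v : Fin n} {g : Fin d → LTr n d k} (hg : T v = some g) (i : Fin d) :
    v ∉ Img e ∧ IG n d k (g i) ∧ v ∉ Vert n d k (g i) ∧ Disjoint (Vert n d k (g i)) (Img e) ∧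
    Disjoint (Vert n d k (g i)) (Img (Function.update e i v)) := by
  have h1 : v ∉ Img e := by
    rw [Finset.disjoint_left] at hdj
    exact hdj ((mem_Vert_succ T v).mpr ⟨v, g, hg, Or.inl rfl⟩)
  have h2 : v ∉ Vert n d k (g i) := hIG.2.1 v g v g hg hg i
  have h3 : Disjoint (Vert n d k (g i)) (Img e) := by
    rw [Finset.disjoint_left] at hdj ⊢
    intro x hx
    exact hdj ((mem_Vert_succ T x).mpr ⟨v, g, hg, Or.inr ⟨i, hx⟩⟩)
  refine ⟨h1, hIG.1 v g hg i, h2, h3, ?_⟩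
  apply Finset.disjoint_of_subset_right (Img_upd_sub e i v)
  rw [Finset.disjoint_insert_right]
  exact ⟨h2, h3⟩

lemma PT_sub : ∀ k (T : LTr n d k) (e : Fin d → Fin n) (s : Finset (Fin n)),
    s ∈ PT n d k T e → s ⊆ Img e ∪ Vert n d k T
  | 0, T, e, s, h => by simp [PT] at h
  | k + 1, T, e, s, h => by
    replace h := (mem_PT_succ _ _ _).mp h
    obtain ⟨v, g, hg, rfl | ⟨i, hi⟩⟩ := h
    · intro x hx
      rw [Finset.mem_insert] at hx
      rw [Finset.mem_union]
      rcases hx with rfl | hx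
      · exact Or.inr ((mem_Vert_succ T x).mpr ⟨x, g, hg, Or.inl rfl⟩)
      · exact Or.inl hx
    · intro x hx
      have h1 := PT_sub k _ _ _ hi hx
      rw [Finset.mem_union] at h1 ⊢
      rcases h1 with h1 | h1
      · have h2 := Img_upd_sub e i v h1
        rw [Finset.mem_insert] at h2
        rcases h2 with rfl | h2
        · exact Or.inr ((mem_Vert_succ T x).mpr ⟨x, g, hg, Or.inl rfl⟩)
        · exact Or.inl h2
      · exact Or.inr ((mem_Vert_succ T x).mpr ⟨v, g, hg, Or.inr ⟨i, h1⟩⟩)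

lemma QT_cases : ∀ k (T : LTr n d k) (e : Fin d → Fin n) (u : Fin n) (s : Finset (Fin n)),
    s ∈ QT n d k T e u → (∃ v, v ∉ Img e ∧ v ≠ u ∧ s = insert v (Img e)) ∨
      ∃ x ∈ s, x ∈ Vert n d k T
  | 0, T, e, u, s, h => by simp [QT] at h
  | k + 1, T, e, u, s, h => by
    replace h := (mem_QT_succ _ _ _ _).mp h
    rcases h with ⟨v, -, h1, h2, h3⟩ | ⟨v, g, hg, i, hi⟩
    · exact Or.inl ⟨v, h1, h2, h3⟩
    · right
      rcases QT_cases k _ _ _ _ hi with ⟨v', -, -, rfl⟩ | ⟨x, hx, hx'⟩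
      · exact ⟨v, Finset.mem_insert_of_mem (mem_Img_upd_self e i v),
          (mem_Vert_succ T v).mpr ⟨v, g, hg, Or.inl rfl⟩⟩
      · exact ⟨x, hx, (mem_Vert_succ T x).mpr ⟨v, g, hg, Or.inr ⟨i, hx'⟩⟩⟩

lemma PT_card : ∀ k (T : LTr n d k) (e : Fin d → Fin n), Function.Injective e → IG n d k T →
    Disjoint (Vert n d k T) (Img e) → ∀ s ∈ PT n d k T e, s.card = d + 1
  | 0, T, e, _, _, _, s, h => by simp [PT] at h
  | k + 1, T, e, he, hIG, hdj, s, h => by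
    replace h := (mem_PT_succ _ _ _).mp h
    obtain ⟨v, g, hg, rfl | ⟨i, hi⟩⟩ := h
    · have hv : v ∉ Img e := by
        rw [Finset.disjoint_left] at hdj
        exact hdj ((mem_Vert_succ T v).mpr ⟨v, g, hg, Or.inl rfl⟩)
      rw [Finset.card_insert_of_notMem hv, card_Img he]
    · obtain ⟨h1, h2, h3, h4, h5⟩ := child_good hIG hdj hg i
      exact PT_card k _ _ (upd_inj he i h1) h2 h5 s hi

lemma QT_card : ∀ k (T : LTr n d k) (e : Fin d → Fin n) (u : Fin n), Function.Injective e →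
    IG n d k T → Disjoint (Vert n d k T) (Img e) → ∀ s ∈ QT n d k T e u, s.card = d + 1
  | 0, T, e, _, _, _, _, s, h => by simp [QT] at h
  | k + 1, T, e, u, he, hIG, hdj, s, h => by
    replace h := (mem_QT_succ _ _ _ _).mp h
    rcases h with ⟨v, -, hv, -, rfl⟩ | ⟨v, g, hg, i, hi⟩
    · rw [Finset.card_insert_of_notMem hv, card_Img he]
    · obtain ⟨h1, h2, h3, h4, h5⟩ := child_good hIG hdj hg i
      exact QT_card k _ _ _ (upd_inj he i h1) h2 h5 s hi

lemma PQ_disj : ∀ k (T : LTr n d k) (e : Fin d → Fin n) (u : Fin n), Function.Injective e →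
    IG n d k T → Disjoint (Vert n d k T) (Img e) →
    ∀ s ∈ PT n d k T e, s ∉ QT n d k T e u
  | 0, T, e, _, _, _, _, s, h => by simp [PT] at h
  | k + 1, T, e, u, he, hIG, hdj, s, h => by
    intro hQ
    replace h := (mem_PT_succ _ _ _).mp h
    replace hQ := (mem_QT_succ _ _ _ _).mp hQ
    obtain ⟨v, g, hg, rfl | ⟨i, hi⟩⟩ := h
    · have hv : v ∉ Img e := by
        rw [Finset.disjoint_left] at hdj
        exact hdj ((mem_Vert_succ T v).mpr ⟨v, g, hg, Or.inl rfl⟩)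
      rcases hQ with ⟨v', hT', hv', -, heq⟩ | ⟨y, g', hg', j, hj⟩
      · have : v ∈ insert v' (Img e) := by rw [← heq]; exact Finset.mem_insert_self _ _
        rw [Finset.mem_insert] at this
        rcases this with rfl | h
        · rw [hg] at hT'; cases hT'
        · exact hv h
      · obtain ⟨h1, h2, h3, h4, h5⟩ := child_good hIG hdj hg' j
        rcases QT_cases k _ _ _ _ hj with ⟨v', hv1, hv2, heq⟩ | ⟨x, hx, hx'⟩
        · have : e j ∈ insert v (Img e) :=
            Finset.mem_insert_of_mem ((mem_Img e _).mpr ⟨j, rfl⟩)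
          rw [heq, Finset.mem_insert] at this
          rcases this with h | h
          · exact hv2 h.symm
          · exact not_mem_Img_upd he j h1 h
        · rw [Finset.mem_insert] at hx
          rcases hx with rfl | hx
          · exact hIG.2.1 y g' x g hg' hg j hx'
          · exact Finset.disjoint_left.mp h4 hx' hx
    · obtain ⟨h1, h2, h3, h4, h5⟩ := child_good hIG hdj hg i
      have hsub := PT_sub k _ _ _ hi
      have hei : e i ∉ s := by
        intro hc
        have := hsub hc
        rw [Finset.mem_union] at this
        rcases this with h | h
        · exact not_mem_Img_upd he i h1 h
        · exact Finset.disjoint_left.mp h4 h ((mem_Img e _).mpr ⟨i, rfl⟩)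
      rcases hQ with ⟨v', hT', hv', -, rfl⟩ | ⟨y, g', hg', j, hj⟩
      · exact hei (Finset.mem_insert_of_mem ((mem_Img e _).mpr ⟨i, rfl⟩))
      · obtain ⟨k1, k2, k3, k4, k5⟩ := child_good hIG hdj hg' j
        by_cases hne : v ≠ y ∨ i ≠ j
        · rcases QT_cases k _ _ _ _ hj with ⟨v', hv1, hv2, heq⟩ | ⟨x, hx, hx'⟩
          · have hys : y ∈ s := by
              rw [heq]; exact Finset.mem_insert_of_mem (mem_Img_upd_self e j y)
            have hy := hsub hys
            rw [Finset.mem_union] at hy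
            rcases hy with hy | hy
            · have := Img_upd_sub e i v hy
              rw [Finset.mem_insert] at this
              rcases this with rfl | h
              · have hij : i ≠ j := by simpa using hne
                apply hei
                rw [heq]
                exact Finset.mem_insert_of_mem (mem_Img_upd_ne e hij y)
              · exact k1 h
            · exact hIG.2.1 v g y g' hg hg' i hy
          · have := hsub hx
            rw [Finset.mem_union] at this
            rcases this with h | h
            · have := Img_upd_sub e i v h
              rw [Finset.mem_insert] at this
              rcases this with rfl | h
              · exact hIG.2.1 y g' x g hg' hg j hx'
              · exact Finset.disjoint_left.mp k4 hx' h
            · exact Finset.disjoint_left.mp (hIG.2.2 v g y g' hg hg' i j hne) h hx'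
        · push Not at hne
          obtain ⟨rfl, rfl⟩ := hne
          rw [hg] at hg'
          obtain rfl := Option.some.inj hg'
          exact PQ_disj k _ _ _ (upd_inj he i h1) h2 h5 s hi hj

lemma Bm_eq (F : Finset (Finset (Fin n))) : ∀ k (T : LTr n d k) (e : Fin d → Fin n) (u : Fin n),
    IG n d k T → Disjoint (Vert n d k T) (Img e) → u ∉ Vert n d k T →
    PT n d k T e ⊆ F → Disjoint (QT n d k T e u) F → Bm n d F k e u = T
  | 0, T, e, u, _, _, _, _, _ => rfl
  | k + 1, T, e, u, hIG, hdj, hu, hP, hQ => by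
    funext v
    change (if v ∉ Img e ∧ v ≠ u ∧ insert v (Img e) ∈ F then
      some (fun i => Bm n d F k (Function.update e i v) (e i)) else none) = T v
    cases hg : T v with
    | none =>
      rw [if_neg]
      rintro ⟨a1, a2, a3⟩
      refine Finset.disjoint_left.mp hQ ?_ a3
      refine (mem_QT_succ _ _ _ _).mpr ?_
      exact Or.inl ⟨v, hg, a1, a2, rfl⟩
    | some g =>
      have hvV : v ∈ Vert n d (k + 1) T := (mem_Vert_succ T v).mpr ⟨v, g, hg, Or.inl rfl⟩
      rw [if_pos]
      · congr 1
        funext i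
        obtain ⟨h1, h2, h3, h4, h5⟩ := child_good hIG hdj hg i
        apply Bm_eq F k (g i) _ _ h2 h5
        · intro hc
          exact Finset.disjoint_left.mp h4 hc ((mem_Img e _).mpr ⟨i, rfl⟩)
        · intro s hs
          exact hP ((mem_PT_succ T e s).mpr ⟨v, g, hg, Or.inr ⟨i, hs⟩⟩)
        · apply Finset.disjoint_of_subset_left _ hQ
          intro s hs
          exact (mem_QT_succ T e u s).mpr (Or.inr ⟨v, g, hg, i, hs⟩)
      · refine ⟨Finset.disjoint_left.mp hdj hvV, ?_, ?_⟩
        · rintro rfl; exact hu hvV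
        · exact hP ((mem_PT_succ T e _).mpr ⟨v, g, hg, Or.inl rfl⟩)

lemma wt_le {p : ℝ} (hp0 : 0 ≤ p) (hp1 : p ≤ 1) : ∀ k (T : LTr n d k) (e : Fin d → Fin n) (u : Fin n),
    wt n d p k T ≤ p ^ (PT n d k T e).card * (1 - p) ^ (QT n d k T e u).card
  | 0, T, e, u => by simp [PT, QT, wt]
  | k + 1, T, e, u => by
    have ih := wt_le hp0 hp1 k
    have hq0 : 0 ≤ 1 - p := by linarith
    have hq1 : 1 - p ≤ 1 := by linarith
    have hw := wt_prob (n := n) (d := d) hp0 hp1 k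
    have step : ∀ v, optw p (piw (wt n d p k)) (T v) ≤
        p ^ (Pc (PT n d k) e v (T v)).card * (1 - p) ^ (Qc (QT n d k) e u v (T v)).card := by
      intro v
      cases h : T v with
      | none =>
        simp only [optw, Pc, Qc, Finset.card_empty, pow_zero, one_mul]
        split_ifs <;> simp [hp0]
      | some g =>
        simp only [optw, piw, Pc, Qc]
        have c1 : (insert (insert v (Img e)) (Finset.univ.biUnion fun i =>
            PT n d k (g i) (Function.update e i v))).card ≤
            ∑ i, (PT n d k (g i) (Function.update e i v)).card + 1 :=
          (Finset.card_insert_le _ _).trans (Nat.add_le_add_right Finset.card_biUnion_le 1)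
        have c2 : (Finset.univ.biUnion fun i =>
            QT n d k (g i) (Function.update e i v) (e i)).card ≤
            ∑ i, (QT n d k (g i) (Function.update e i v) (e i)).card := Finset.card_biUnion_le
        calc p * ∏ i, wt n d p k (g i) ≤ p * ∏ i,
              (p ^ (PT n d k (g i) (Function.update e i v)).card *
                (1 - p) ^ (QT n d k (g i) (Function.update e i v) (e i)).card) := by
              apply mul_le_mul_of_nonneg_left _ hp0
              exact Finset.prod_le_prod (fun i _ => hw.nonneg _) (fun i _ => ih _ _ _)
          _ = p ^ (∑ i, (PT n d k (g i) (Function.update e i v)).card + 1) *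
              (1 - p) ^ (∑ i, (QT n d k (g i) (Function.update e i v) (e i)).card) := by
              rw [Finset.prod_mul_distrib, Finset.prod_pow_eq_pow_sum, Finset.prod_pow_eq_pow_sum]
              ring
          _ ≤ _ := mul_le_mul (pow_le_pow_of_le_one hp0 hp1 c1)
              (pow_le_pow_of_le_one hq0 hq1 c2) (by positivity) (by positivity)
    have c1 : (PT n d (k + 1) T e).card ≤ ∑ v, (Pc (PT n d k) e v (T v)).card :=
      Finset.card_biUnion_le
    have c2 : (QT n d (k + 1) T e u).card ≤ ∑ v, (Qc (QT n d k) e u v (T v)).card :=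
      Finset.card_biUnion_le
    calc wt n d p (k + 1) T = ∏ v, optw p (piw (wt n d p k)) (T v) := rfl
      _ ≤ ∏ v, (p ^ (Pc (PT n d k) e v (T v)).card *
            (1 - p) ^ (Qc (QT n d k) e u v (T v)).card) :=
          Finset.prod_le_prod (fun v _ => (optw_prob hp0 hp1 (piw_prob hw)).nonneg _)
            (fun v _ => step v)
      _ = p ^ (∑ v, (Pc (PT n d k) e v (T v)).card) *
            (1 - p) ^ (∑ v, (Qc (QT n d k) e u v (T v)).card) := by
          rw [Finset.prod_mul_distrib, Finset.prod_pow_eq_pow_sum, Finset.prod_pow_eq_pow_sum]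
      _ ≤ _ := mul_le_mul (pow_le_pow_of_le_one hp0 hp1 c1)
              (pow_le_pow_of_le_one hq0 hq1 c2) (by positivity) (by positivity)

end coupling
end

noncomputable section

section residual
variable {n d : ℕ}

lemma bdCoeff_eq (τ σ : Finset (Fin n)) : bdCoeff τ σ =
    ∑ x ∈ σ, if τ = σ.erase x then (-1 : ℝ) ^ (σ.filter (fun w => w < x)).card else 0 := by
  unfold bdCoeff
  split_ifs with h
  · obtain ⟨hs, hc⟩ := h
    have h1 : (σ \ τ).card = 1 := by rw [Finset.card_sdiff_of_subset hs]; omega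
    obtain ⟨y, hy⟩ := Finset.card_eq_one.mp h1
    have hyσ : y ∈ σ := by
      have : y ∈ σ \ τ := by rw [hy]; simp
      exact (Finset.mem_sdiff.mp this).1
    have hτ : τ = σ.erase y := by
      rw [Finset.erase_eq, ← hy, Finset.sdiff_sdiff_eq_self hs]
    rw [hy, Finset.sum_singleton, Finset.sum_eq_single y]
    · simp [hτ]
    · intro x hx hxy
      rw [if_neg]
      intro hc
      rw [hτ] at hc
      exact hxy ((Finset.erase_injOn σ (by simpa using hyσ) (by simpa using hx) hc).symm)
    · intro h; exact absurd hyσ h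
  · symm
    apply Finset.sum_eq_zero
    intro x hx
    rw [if_neg]
    rintro rfl
    exact h ⟨Finset.erase_subset _ _, Finset.card_erase_add_one hx⟩

lemma erase_Img_upd {e : Fin d → Fin n} (he : Function.Injective e) {v : Fin n} (hv : v ∉ Img e)
    (i : Fin d) : (insert v (Img e)).erase (e i) = Img (Function.update e i v) := by
  have hi : e i ∈ insert v (Img e) := Finset.mem_insert_of_mem ((mem_Img e _).mpr ⟨i, rfl⟩)
  symm
  apply Finset.eq_of_subset_of_card_le
  · intro x hx
    rw [Finset.mem_erase]
    refine ⟨?_, Img_upd_sub e i v hx⟩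
    rintro rfl
    exact not_mem_Img_upd he i hv hx
  · rw [Finset.card_erase_of_mem hi, Finset.card_insert_of_notMem hv, card_Img he,
      card_Img (upd_inj he i hv)]
    simp

lemma face_rel {F : Finset (Finset (Fin n))} {e : Fin d → Fin n} (he : Function.Injective e)
    {v : Fin n} (hv : v ∉ Img e) (hF : insert v (Img e) ∈ F) :
    ∃ ε : Fin d → ℝ, (∀ i, ε i ^ 2 = 1) ∧
      (∑ i, ε i • (Pi.single (Img (Function.update e i v)) 1 : Finset (Fin n) → ℝ))
        - Pi.single (Img e) 1 ∈ LinearMap.range (boundaryMap n F) := by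
  set σ := insert v (Img e) with hσ
  set sg : Fin n → ℝ := fun x => (-1 : ℝ) ^ (σ.filter (fun w => w < x)).card with hsg
  have hsq : ∀ x, sg x * sg x = 1 := by
    intro x
    simp only [hsg]
    rw [← mul_pow]; simp
  refine ⟨fun i => - (sg v * sg (e i)), fun i => ?_, ?_⟩
  · have h1 := hsq v
    have h2 := hsq (e i)
    calc (-(sg v * sg (e i))) ^ 2 = (sg v * sg v) * (sg (e i) * sg (e i)) := by ring
      _ = 1 := by rw [h1, h2, one_mul]
  · refine ⟨Pi.single ⟨σ, hF⟩ (- sg v), ?_⟩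
    funext τ
    have h1 : boundaryMap n F (Pi.single ⟨σ, hF⟩ (- sg v)) τ = - sg v * bdCoeff τ σ := by
      change ∑ s ∈ F.attach, (Pi.single (⟨σ, hF⟩ : F) (- sg v) : F → ℝ) s * bdCoeff τ s.1 = _
      rw [Finset.sum_eq_single ⟨σ, hF⟩]
      · simp
      · intro b _ hb
        simp [Pi.single_eq_of_ne hb]
      · simp
    rw [h1, bdCoeff_eq, hσ, Finset.sum_insert hv, Finset.erase_insert hv]
    have h2 : ∑ x ∈ Img e, (if τ = σ.erase x then sg x else 0) =
        ∑ i, if τ = Img (Function.update e i v) then sg (e i) else 0 := by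
      rw [Img, Finset.sum_image (fun a _ b _ h => he h)]
      refine Finset.sum_congr rfl fun i _ => ?_
      rw [hσ, erase_Img_upd he hv i]
    have h2' : ∑ x ∈ Img e, (if τ = (insert v (Img e)).erase x then
        (-1 : ℝ) ^ ((insert v (Img e)).filter (fun w => w < x)).card else 0) =
        ∑ i, if τ = Img (Function.update e i v) then sg (e i) else 0 := h2
    rw [h2']
    change - sg v * ((if τ = Img e then sg v else 0) + _) = _
    simp only [Pi.sub_apply, Finset.sum_apply, Pi.smul_apply, smul_eq_mul, Pi.single_apply]
    rw [mul_add, Finset.mul_sum]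
    have h3 : ∀ i, - sg v * (if τ = Img (Function.update e i v) then sg (e i) else 0) =
        -(sg v * sg (e i)) * (if τ = Img (Function.update e i v) then 1 else 0) := by
      intro i
      split_ifs <;> ring
    simp only [h3]
    have h4 : - sg v * (if τ = Img e then sg v else 0) = - (if τ = Img e then 1 else 0) := by
      split_ifs
      · linarith [hsq v]
      · ring
    rw [h4]
    ring

lemma sq_sum_of_unique {κ : Type} [Fintype κ] (f : κ → ℝ)
    (h : ∀ a b, f a ≠ 0 → f b ≠ 0 → a = b) : (∑ a, f a) ^ 2 = ∑ a, f a ^ 2 := by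
  by_cases h0 : ∃ a, f a ≠ 0
  · obtain ⟨a, ha⟩ := h0
    have hz : ∀ b, b ≠ a → f b = 0 := fun b hb => by
      by_contra hc
      exact hb (h b a hc ha)
    rw [Finset.sum_eq_single a (fun b _ hb => hz b hb) (by simp),
      Finset.sum_eq_single a (fun b _ hb => by simp [hz b hb]) (by simp)]
  · push Not at h0
    simp [h0]

lemma treeResidual (hd : 0 < d) (F : Finset (Finset (Fin n))) : ∀ k (T : LTr n d k) (e : Fin d → Fin n),
    Function.Injective e → IG n d k T → Disjoint (Vert n d k T) (Img e) → PT n d k T e ⊆ F →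
    ∃ r : Finset (Fin n) → ℝ, r - Pi.single (Img e) 1 ∈ LinearMap.range (boundaryMap n F) ∧
      ∑ s, r s ^ 2 = xv n d k T ∧
      ∀ s, r s ≠ 0 → s = Img e ∨ ((∃ x ∈ s, x ∈ Vert n d k T) ∧ s ⊆ Img e ∪ Vert n d k T)
  | 0, T, e, _, _, _, _ => by
    refine ⟨Pi.single (Img e) 1, by simp, ?_, ?_⟩
    · simp [Pi.single_apply, xv]
    · intro s hs
      left
      by_contra h
      exact hs (by simp [Pi.single_apply, h])
  | k + 1, T, e, he, hIG, hdj, hP => by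
    have ih := treeResidual hd F k
    have hR : ∀ (v : Fin n) (i : Fin d), ∃ r : Finset (Fin n) → ℝ, ∀ g, T v = some g →
        r - Pi.single (Img (Function.update e i v)) 1 ∈ LinearMap.range (boundaryMap n F) ∧
        ∑ s, r s ^ 2 = xv n d k (g i) ∧
        ∀ s, r s ≠ 0 → s = Img (Function.update e i v) ∨
          ((∃ x ∈ s, x ∈ Vert n d k (g i)) ∧
            s ⊆ Img (Function.update e i v) ∪ Vert n d k (g i)) := by
      intro v i
      cases hg : T v with
      | none => exact ⟨0, fun g h => by cases h⟩
      | some g =>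
        obtain ⟨h1, h2, h3, h4, h5⟩ := child_good hIG hdj hg i
        obtain ⟨r, hr⟩ := ih (g i) (Function.update e i v) (upd_inj he i h1) h2 h5
          (fun s hs => hP ((mem_PT_succ T e s).mpr ⟨v, g, hg, Or.inr ⟨i, hs⟩⟩))
        refine ⟨r, fun g' h => ?_⟩
        obtain rfl := Option.some.inj h
        exact hr
    have hE : ∀ v : Fin n, ∃ ε : Fin d → ℝ, ∀ g, T v = some g → (∀ i, ε i ^ 2 = 1) ∧
      (∑ i, ε i • (Pi.single (Img (Function.update e i v)) 1 : Finset (Fin n) → ℝ))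
        - Pi.single (Img e) 1 ∈ LinearMap.range (boundaryMap n F) := by
      intro v
      cases hg : T v with
      | none => exact ⟨0, fun g h => by cases h⟩
      | some g =>
        have h1 : v ∉ Img e := Finset.disjoint_left.mp hdj
          ((mem_Vert_succ T v).mpr ⟨v, g, hg, Or.inl rfl⟩)
        obtain ⟨ε, hε⟩ := face_rel he h1 (hP ((mem_PT_succ T e _).mpr ⟨v, g, hg, Or.inl rfl⟩))
        exact ⟨ε, fun _ _ => hε⟩
    choose R hR using hR
    choose ε hε using hE
    set x := Yst (xv n d k) T with hx
    set O : Fin n → ℝ := fun v => oinv (xv n d k) (T v) with hO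
    have hO0 : 0 ≤ ∑ v, O v := Finset.sum_nonneg fun v _ => oinv_nonneg hd (xv_pos hd k) _
    have hxO : x * (1 + ∑ v, O v) = 1 := by
      rw [hx]; unfold Yst
      have : (1 + ∑ v, O v) ≠ 0 := by positivity
      exact one_div_mul_cancel this
    have hOsome : ∀ v, O v ≠ 0 → ∃ g, T v = some g := by
      intro v h
      cases hg : T v with
      | none => exact absurd (by simp [hO, hg, oinv]) h
      | some g => exact ⟨g, rfl⟩
    let f : Option (Fin n × Fin d) → Finset (Fin n) → ℝ := fun q => match q with
      | none => x • Pi.single (Img e) 1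
      | some q => (x * O q.1 * ε q.1 q.2) • R q.1 q.2
    have fnone : ∀ s, f none s ≠ 0 → s = Img e := by
      intro s hs
      by_contra h
      exact hs (by simp [f, Pi.single_apply, h])
    have fsome : ∀ v i s, f (some (v, i)) s ≠ 0 → ∃ g, T v = some g ∧
        (s = Img (Function.update e i v) ∨ ((∃ x ∈ s, x ∈ Vert n d k (g i)) ∧
            s ⊆ Img (Function.update e i v) ∪ Vert n d k (g i))) := by
      intro v i s hs
      have h1 : O v ≠ 0 := by
        intro h
        exact hs (by simp [f, h])
      have h2 : R v i s ≠ 0 := by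
        intro h
        exact hs (by simp [f, h])
      obtain ⟨g, hg⟩ := hOsome v h1
      exact ⟨g, hg, (hR v i g hg).2.2 s h2⟩
    -- at most one
    have hnone_some : ∀ v i s, f none s ≠ 0 → f (some (v, i)) s ≠ 0 → False := by
      intro v i s h1 h2
      have e1 := fnone s h1
      obtain ⟨g, hg, h⟩ := fsome v i s h2
      obtain ⟨a1, a2, a3, a4, a5⟩ := child_good hIG hdj hg i
      rcases h with h | ⟨⟨y, hy, hy'⟩, -⟩
      · apply a1
        rw [← e1, h]
        exact mem_Img_upd_self e i v
      · rw [e1] at hy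
        exact Finset.disjoint_left.mp a4 hy' hy
    have hmix : ∀ v i u j s g g', T v = some g → T u = some g' → (v ≠ u ∨ i ≠ j) →
        (s = Img (Function.update e i v) ∨ s ⊆ Img (Function.update e i v) ∪ Vert n d k (g i)) →
        (∃ x ∈ s, x ∈ Vert n d k (g' j)) → False := by
      rintro v i u j s g g' hg hg' hne hs ⟨y, hy, hy'⟩
      obtain ⟨a1, a2, a3, a4, a5⟩ := child_good hIG hdj hg' j
      have hs' : s ⊆ Img (Function.update e i v) ∪ Vert n d k (g i) := by
        rcases hs with rfl | hs
        · exact Finset.subset_union_left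
        · exact hs
      have h1 := hs' hy
      rw [Finset.mem_union] at h1
      rcases h1 with h1 | h1
      · have := Img_upd_sub e i v h1
        rw [Finset.mem_insert] at this
        rcases this with rfl | h
        · exact hIG.2.1 u g' y g hg' hg j hy'
        · exact Finset.disjoint_left.mp a4 hy' h
      · exact Finset.disjoint_left.mp (hIG.2.2 v g u g' hg hg' i j hne) h1 hy'
    have hsome : ∀ v i u j s, f (some (v, i)) s ≠ 0 → f (some (u, j)) s ≠ 0 → v = u ∧ i = j := by
      intro v i u j s h1 h2
      obtain ⟨g, hg, h⟩ := fsome v i s h1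
      obtain ⟨g', hg', h'⟩ := fsome u j s h2
      by_contra hcon
      have hne : v ≠ u ∨ i ≠ j := by tauto
      have hne' : u ≠ v ∨ j ≠ i := by
        rcases hne with h | h
        · exact Or.inl h.symm
        · exact Or.inr h.symm
      rcases h' with h' | ⟨h', h''⟩
      · rcases h with h | ⟨h, h3⟩
        · obtain ⟨a1, -⟩ := child_good hIG hdj hg i
          obtain ⟨b1, -⟩ := child_good hIG hdj hg' j
          have hv : v ∈ Img (Function.update e j u) := by
            rw [← h', h]; exact mem_Img_upd_self e i v
          have := Img_upd_sub e j u hv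
          rw [Finset.mem_insert] at this
          rcases this with rfl | h4
          · have hij : i ≠ j := by simpa using hne
            apply not_mem_Img_upd he i a1
            rw [← h, h']
            exact mem_Img_upd_ne e hij v
          · exact a1 h4
        · exact hmix u j v i s g' g hg' hg hne' (Or.inl h') h
      · exact hmix v i u j s g g' hg hg' hne (h.imp id And.right) h'
    have hone : ∀ s (a b : Option (Fin n × Fin d)), f a s ≠ 0 → f b s ≠ 0 → a = b := by
      intro s a b ha hb
      rcases a with _ | ⟨v, i⟩ <;> rcases b with _ | ⟨u, j⟩
      · rfl
      · exact (hnone_some u j s ha hb).elim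
      · exact (hnone_some v i s hb ha).elim
      · obtain ⟨rfl, rfl⟩ := hsome v i u j s ha hb
        rfl
    refine ⟨fun s => ∑ q, f q s, ?_, ?_, ?_⟩
    · have hsplit : (fun s => ∑ q, f q s) - (Pi.single (Img e) 1 : Finset (Fin n) → ℝ) =
          ∑ v, (x * O v) • ((∑ i, ε v i • R v i) - Pi.single (Img e) 1) := by
        have e1 : (fun s => ∑ q, f q s) = x • (Pi.single (Img e) 1 : Finset (Fin n) → ℝ) +
            ∑ v, (x * O v) • (∑ i, ε v i • R v i) := by
          funext s
          rw [Fintype.sum_option, Fintype.sum_prod_type]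
          simp only [Pi.add_apply, Finset.sum_apply, Pi.smul_apply, smul_eq_mul, f, Finset.mul_sum,
            mul_assoc]
        rw [e1]
        simp only [smul_sub, Finset.sum_sub_distrib]
        have e2 : ∑ v, (x * O v) • (Pi.single (Img e) 1 : Finset (Fin n) → ℝ) =
            (1 - x) • (Pi.single (Img e) 1 : Finset (Fin n) → ℝ) := by
          rw [← Finset.sum_smul, ← Finset.mul_sum]
          congr 1
          linarith
        rw [e2, sub_smul, one_smul]
        abel
      rw [hsplit]
      apply Submodule.sum_mem
      intro v _
      by_cases h : O v = 0
      · rw [h, mul_zero, zero_smul]; exact Submodule.zero_mem _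
      · obtain ⟨g, hg⟩ := hOsome v h
        apply Submodule.smul_mem
        have e3 : (∑ i, ε v i • R v i) - (Pi.single (Img e) 1 : Finset (Fin n) → ℝ) =
            ∑ i, ε v i • (R v i - Pi.single (Img (Function.update e i v)) 1) +
            ((∑ i, ε v i • (Pi.single (Img (Function.update e i v)) 1 : Finset (Fin n) → ℝ))
              - Pi.single (Img e) 1) := by
          simp only [smul_sub, Finset.sum_sub_distrib]
          abel
        rw [e3]
        apply Submodule.add_mem _ _ (hε v g hg).2
        apply Submodule.sum_mem
        intro i _
        exact Submodule.smul_mem _ _ (hR v i g hg).1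
    · have e1 : ∀ s, (∑ q, f q s) ^ 2 = ∑ q, f q s ^ 2 := fun s => sq_sum_of_unique _ (hone s)
      simp only [e1]
      rw [Finset.sum_comm, Fintype.sum_option, Fintype.sum_prod_type]
      have e2 : ∑ s, f none s ^ 2 = x ^ 2 := by
        simp [f, Pi.single_apply]
      have e3 : ∀ v, ∑ i, ∑ s, f (some (v, i)) s ^ 2 = x ^ 2 * O v := by
        intro v
        by_cases h : O v = 0
        · simp [f, h]
        · obtain ⟨g, hg⟩ := hOsome v h
          have e4 : ∀ i, ∑ s, f (some (v, i)) s ^ 2 = (x * O v) ^ 2 * xv n d k (g i) := by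
            intro i
            rw [← (hR v i g hg).2.1, Finset.mul_sum]
            refine Finset.sum_congr rfl fun s _ => ?_
            simp only [f, Pi.smul_apply, smul_eq_mul]
            have := (hε v g hg).1 i
            calc (x * O v * ε v i * R v i s) ^ 2 = (x * O v) ^ 2 * (R v i s) ^ 2 * (ε v i ^ 2) := by ring
              _ = _ := by rw [this, mul_one]
          simp only [e4]
          rw [← Finset.mul_sum]
          have e5 : O v = 1 / Sg (xv n d k) g := by simp only [hO, hg]; rfl
          have e6 : ∑ i, xv n d k (g i) = Sg (xv n d k) g := rfl
          have hS := Sg_pos hd (xv_pos hd k) g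
          rw [e6, e5]
          field_simp
      rw [e2]
      simp only [e3]
      rw [← Finset.mul_sum]
      change _ = x
      calc x ^ 2 + x ^ 2 * ∑ v, O v = x * (x * (1 + ∑ v, O v)) := by ring
        _ = x := by rw [hxO, mul_one]
    · intro s hs
      obtain ⟨q, -, hq⟩ := Finset.exists_ne_zero_of_sum_ne_zero hs
      rcases q with _ | ⟨v, i⟩
      · exact Or.inl (fnone s hq)
      · right
        obtain ⟨g, hg, h⟩ := fsome v i s hq
        have hvV : v ∈ Vert n d (k + 1) T := (mem_Vert_succ T v).mpr ⟨v, g, hg, Or.inl rfl⟩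
        have hsub : Img (Function.update e i v) ⊆ Img e ∪ Vert n d (k + 1) T := by
          intro y hy
          have := Img_upd_sub e i v hy
          rw [Finset.mem_insert] at this
          rw [Finset.mem_union]
          rcases this with rfl | h
          · exact Or.inr hvV
          · exact Or.inl h
        have hV : Vert n d k (g i) ⊆ Vert n d (k + 1) T := fun y hy =>
          (mem_Vert_succ T y).mpr ⟨v, g, hg, Or.inr ⟨i, hy⟩⟩
        rcases h with rfl | ⟨⟨y, hy, hy'⟩, h⟩
        · exact ⟨⟨v, mem_Img_upd_self e i v, hvV⟩, hsub⟩
        · refine ⟨⟨y, hy, hV hy'⟩, h.trans (Finset.union_subset hsub ?_)⟩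
          exact hV.trans Finset.subset_union_right

end residual
end

noncomputable section

lemma rank_lower {ι : Type} [Fintype ι] [DecidableEq ι] (V : Submodule ℝ (ι → ℝ)) (D : Finset ι)
    (x : ι → ℝ) (hx : ∀ t ∈ D, ∃ r : ι → ℝ, r - Pi.single t 1 ∈ V ∧ ∑ s, r s ^ 2 ≤ x t) :
    ∑ t ∈ D, (1 - x t) ≤ Module.finrank ℝ V := by
  let L : EuclideanSpace ℝ ι ≃ₗ[ℝ] (ι → ℝ) := WithLp.linearEquiv 2 ℝ (ι → ℝ)
  let W : Submodule ℝ (EuclideanSpace ℝ ι) := V.map L.symm.toLinearMap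
  have hfin : Module.finrank ℝ W = Module.finrank ℝ V :=
    LinearEquiv.finrank_map_eq L.symm V
  let b := stdOrthonormalBasis ℝ W
  have h1 : ∀ t ∈ D, 1 - x t ≤ ∑ j, ((b j : EuclideanSpace ℝ ι) t) ^ 2 := by
    intro t ht
    obtain ⟨r, hr, hrx⟩ := hx t ht
    set w0 : ι → ℝ := r - Pi.single t 1 with hw0
    have hwW : L.symm w0 ∈ W := Submodule.mem_map_of_mem hr
    let w : W := ⟨L.symm w0, hwW⟩
    have hrep : ∀ s, w0 s = ∑ j, inner ℝ (b j) w * (b j : EuclideanSpace ℝ ι) s := by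
      intro s
      have h2 := b.sum_repr' w
      have h3 : ((∑ j, inner ℝ (b j) w • b j : W) : EuclideanSpace ℝ ι) = (w : EuclideanSpace ℝ ι) := by
        rw [h2]
      have h4 := congrArg (fun z : EuclideanSpace ℝ ι => z s) h3
      simp only [Submodule.coe_sum, Submodule.coe_smul] at h4
      have h5 : (w : EuclideanSpace ℝ ι) s = w0 s := rfl
      rw [← h5, ← h4]
      simp
    have hnorm : ∑ s, w0 s ^ 2 = ∑ j, (inner ℝ (b j) w : ℝ) ^ 2 := by
      have h2 := b.sum_sq_norm_inner_right w
      have h3 : ‖w‖ ^ 2 = ∑ s, w0 s ^ 2 := by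
        change ‖(w : EuclideanSpace ℝ ι)‖ ^ 2 = _
        rw [EuclideanSpace.norm_sq_eq]
        refine Finset.sum_congr rfl fun s _ => ?_
        rw [Real.norm_eq_abs, sq_abs]
        rfl
      rw [← h3, ← h2]
      refine Finset.sum_congr rfl fun j _ => ?_
      rw [Real.norm_eq_abs, sq_abs]
    have hr2 : ∑ s, r s ^ 2 = 1 + 2 * w0 t + ∑ s, w0 s ^ 2 := by
      have : ∀ s, r s ^ 2 = (if s = t then 1 else 0) + 2 * (if s = t then w0 s else 0) + w0 s ^ 2 := by
        intro s
        simp only [hw0, Pi.sub_apply, Pi.single_apply]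
        split_ifs <;> ring
      simp only [this, Finset.sum_add_distrib, ← Finset.mul_sum]
      simp
    rw [hnorm, hrep t, Finset.mul_sum] at hr2
    have h6 : 0 ≤ ∑ j, (inner ℝ (b j) w + (b j : EuclideanSpace ℝ ι) t) ^ 2 :=
      Finset.sum_nonneg fun j _ => sq_nonneg _
    have h7 : ∑ j, (inner ℝ (b j) w + (b j : EuclideanSpace ℝ ι) t) ^ 2 =
        ∑ j, 2 * (inner ℝ (b j) w * (b j : EuclideanSpace ℝ ι) t) + ∑ j, (inner ℝ (b j) w : ℝ) ^ 2
          + ∑ j, ((b j : EuclideanSpace ℝ ι) t) ^ 2 := by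
      rw [← Finset.sum_add_distrib, ← Finset.sum_add_distrib]
      refine Finset.sum_congr rfl fun j _ => by ring
    linarith
  have h2 : ∀ j, ∑ t, ((b j : EuclideanSpace ℝ ι) t) ^ 2 = 1 := by
    intro j
    have h3 : ‖(b j : EuclideanSpace ℝ ι)‖ = 1 := b.norm_eq_one j
    have h4 := EuclideanSpace.norm_sq_eq (b j : EuclideanSpace ℝ ι)
    rw [h3] at h4
    simp only [Real.norm_eq_abs, sq_abs] at h4
    linarith
  calc ∑ t ∈ D, (1 - x t) ≤ ∑ t ∈ D, ∑ j, ((b j : EuclideanSpace ℝ ι) t) ^ 2 :=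
        Finset.sum_le_sum h1
    _ ≤ ∑ t, ∑ j, ((b j : EuclideanSpace ℝ ι) t) ^ 2 :=
        Finset.sum_le_sum_of_subset_of_nonneg (Finset.subset_univ _)
          (fun t _ _ => Finset.sum_nonneg fun j _ => sq_nonneg _)
    _ = ∑ j, ∑ t, ((b j : EuclideanSpace ℝ ι) t) ^ 2 := Finset.sum_comm
    _ = Module.finrank ℝ V := by
        simp only [h2]
        simp [hfin]

lemma dimKer_le {n : ℕ} (F : Finset (Finset (Fin n))) (D : Finset (Finset (Fin n)))
    (x : Finset (Fin n) → ℝ) (hx : ∀ t ∈ D, ∃ r : Finset (Fin n) → ℝ,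
      r - Pi.single t 1 ∈ LinearMap.range (boundaryMap n F) ∧ ∑ s, r s ^ 2 ≤ x t) :
    (dimKer n F : ℝ) ≤ F.card - ∑ t ∈ D, (1 - x t) := by
  have h1 := rank_lower (LinearMap.range (boundaryMap n F)) D x hx
  have h2 := LinearMap.finrank_range_add_finrank_ker (boundaryMap n F)
  rw [Module.finrank_fintype_fun_eq_card, Fintype.card_coe] at h2
  have h3 : (Module.finrank ℝ (LinearMap.range (boundaryMap n F)) : ℝ) + dimKer n F = F.card := by
    unfold dimKer
    exact_mod_cast h2
  linarith

/-- cylinder probabilities -/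
lemma cyl {β : Type} (S P Q : Finset β) (hP : P ⊆ S) (hQ : Q ⊆ S) (hPQ : Disjoint P Q) (p : ℝ) :
    ∑ F ∈ S.powerset, p ^ F.card * (1 - p) ^ (S.card - F.card) *
      (if P ⊆ F ∧ Disjoint Q F then (1 : ℝ) else 0) = p ^ P.card * (1 - p) ^ Q.card := by
  have h := Finset.prod_add (fun i => if i ∈ Q then (0 : ℝ) else p)
    (fun i => if i ∈ P then (0 : ℝ) else 1 - p) S
  have hL : ∏ i ∈ S, ((if i ∈ Q then (0 : ℝ) else p) + (if i ∈ P then (0 : ℝ) else 1 - p)) =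
      p ^ P.card * (1 - p) ^ Q.card := by
    have : ∀ i, ((if i ∈ Q then (0 : ℝ) else p) + (if i ∈ P then (0 : ℝ) else 1 - p)) =
        (if i ∈ P then p else 1) * (if i ∈ Q then 1 - p else 1) := by
      intro i
      by_cases h1 : i ∈ P
      · have := Finset.disjoint_left.mp hPQ h1
        simp [h1, this]
      · by_cases h2 : i ∈ Q <;> simp [h1, h2]
    simp only [this, Finset.prod_mul_distrib, Finset.prod_ite_mem,
      Finset.inter_eq_right.mpr hP, Finset.inter_eq_right.mpr hQ, Finset.prod_const]
  rw [hL] at h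
  rw [h]
  refine Finset.sum_congr rfl fun F hF => ?_
  have hF' := Finset.mem_powerset.mp hF
  split_ifs with hc
  · have e1 : ∏ a ∈ F, (if a ∈ Q then (0 : ℝ) else p) = p ^ F.card := by
      rw [← Finset.prod_const]
      refine Finset.prod_congr rfl fun a ha => ?_
      rw [if_neg (Finset.disjoint_right.mp hc.2 ha)]
    have e2 : ∏ a ∈ S \ F, (if a ∈ P then (0 : ℝ) else 1 - p) = (1 - p) ^ (S.card - F.card) := by
      rw [← Finset.card_sdiff_of_subset hF', ← Finset.prod_const]
      refine Finset.prod_congr rfl fun a ha => ?_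
      rw [if_neg]
      intro hap
      exact (Finset.mem_sdiff.mp ha).2 (hc.1 hap)
    rw [e1, e2, mul_one]
  · rw [mul_zero]
    symm
    by_cases h1 : P ⊆ F
    · have h2 : ¬ Disjoint Q F := fun h => hc ⟨h1, h⟩
      rw [Finset.not_disjoint_iff] at h2
      obtain ⟨a, ha, ha'⟩ := h2
      rw [Finset.prod_eq_zero ha' (by simp [ha]), zero_mul]
    · rw [Finset.not_subset] at h1
      obtain ⟨a, ha, ha'⟩ := h1
      rw [Finset.prod_eq_zero (Finset.mem_sdiff.mpr ⟨hP ha, ha'⟩) (by simp [ha]), mul_zero]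

section final
variable {n d : ℕ}

lemma expectY_mono {p : ℝ} (hp0 : 0 ≤ p) (hp1 : p ≤ 1) {X Y : Finset (Finset (Fin n)) → ℝ}
    (h : ∀ F, X F ≤ Y F) : expectY n d p X ≤ expectY n d p Y := by
  have : 0 ≤ 1 - p := by linarith
  exact Finset.sum_le_sum fun F _ => mul_le_mul_of_nonneg_left (h F) (by positivity)

lemma expectY_sub (p : ℝ) (X Y : Finset (Finset (Fin n)) → ℝ) :
    expectY n d p (fun F => X F - Y F) = expectY n d p X - expectY n d p Y := by
  simp [expectY, mul_sub]

lemma expectY_sum {κ : Type} (s : Finset κ) (p : ℝ) (X : κ → Finset (Finset (Fin n)) → ℝ) :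
    expectY n d p (fun F => ∑ k ∈ s, X k F) = ∑ k ∈ s, expectY n d p (X k) := by
  simp only [expectY, Finset.mul_sum]
  rw [Finset.sum_comm]

lemma expectY_card (p : ℝ) : expectY n d p (fun F => (F.card : ℝ)) = p * n.choose (d + 1) := by
  have h1 : expectY n d p (fun F => (F.card : ℝ)) =
      expectY n d p (fun F => ∑ s ∈ allFaces n d, if {s} ⊆ F ∧ Disjoint ∅ F then (1 : ℝ) else 0) := by
    unfold expectY
    refine Finset.sum_congr rfl fun F hF => ?_
    have hF' := Finset.mem_powerset.mp hF
    congr 1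
    simp only [Finset.singleton_subset_iff, Finset.disjoint_empty_left, and_true]
    rw [Finset.sum_ite_mem, Finset.inter_eq_right.mpr hF']
    simp
  rw [h1, expectY_sum]
  have h2 : ∀ s ∈ allFaces n d, expectY n d p
      (fun F => if {s} ⊆ F ∧ Disjoint ∅ F then (1 : ℝ) else 0) = p := by
    intro s hs
    have := cyl (allFaces n d) {s} ∅ (by simpa using hs) (by simp) (by simp) p
    simpa [expectY] using this
  rw [Finset.sum_congr rfl h2]
  have h3 : (allFaces n d).card = n.choose (d + 1) := by
    have : allFaces n d = Finset.powersetCard (d + 1) Finset.univ := by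
      ext s
      simp [allFaces, Finset.mem_powersetCard]
    rw [this]
    simp
  rw [Finset.sum_const, h3, nsmul_eq_mul, mul_comm]

/-- local contribution at a `d`-set -/
def Xloc (hd : 0 < d) (k : ℕ) (e : Fin d → Fin n) (F : Finset (Finset (Fin n))) : ℝ :=
  if Good n d k (Img e) (Bm n d F k e (e ⟨0, hd⟩)) ∧ PT n d k (Bm n d F k e (e ⟨0, hd⟩)) e ⊆ F
  then 1 - xv n d k (Bm n d F k e (e ⟨0, hd⟩)) else 0

lemma Xloc_res (hd : 0 < d) (k : ℕ) {e : Fin d → Fin n} (he : Function.Injective e)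
    (F : Finset (Finset (Fin n))) : ∃ r : Finset (Fin n) → ℝ,
      r - Pi.single (Img e) 1 ∈ LinearMap.range (boundaryMap n F) ∧
      ∑ s, r s ^ 2 ≤ 1 - Xloc hd k e F := by
  unfold Xloc
  split_ifs with h
  · obtain ⟨r, h1, h2, -⟩ := treeResidual hd F k _ e he h.1.1 h.1.2 h.2
    exact ⟨r, h1, by rw [h2]; linarith⟩
  · refine ⟨Pi.single (Img e) 1, by simp, ?_⟩
    simp [Pi.single_apply]

lemma Xloc_exp (hd : 0 < d) (k : ℕ) {e : Fin d → Fin n} (he : Function.Injective e)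
    {p : ℝ} (hp0 : 0 ≤ p) (hp1 : p ≤ 1) :
    1 - Ex (wt n d p k) (xv n d k) - Pr (wt n d p k) (fun T => ¬ Good n d k (Img e) T) ≤
      expectY n d p (Xloc hd k e) := by
  have hw := wt_prob (n := n) (d := d) hp0 hp1 k
  set u := e ⟨0, hd⟩ with hu
  have huI : u ∈ Img e := (mem_Img e _).mpr ⟨_, rfl⟩
  have h1 : expectY n d p (fun F => ∑ T : LTr n d k,
      (if Good n d k (Img e) T then 1 - xv n d k T else 0) *
      (if PT n d k T e ⊆ F ∧ Disjoint (QT n d k T e u) F then (1 : ℝ) else 0)) ≤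
      expectY n d p (Xloc hd k e) := by
    apply expectY_mono hp0 hp1
    intro F
    have hnn : 0 ≤ Xloc hd k e F := by
      unfold Xloc
      split_ifs
      · linarith [xv_le_one hd k (Bm n d F k e (e ⟨0, hd⟩))]
      · exact le_rfl
    have hB : ∀ T : LTr n d k, Good n d k (Img e) T →
        PT n d k T e ⊆ F ∧ Disjoint (QT n d k T e u) F → Bm n d F k e u = T := by
      intro T hT h
      exact Bm_eq F k T e u hT.1 hT.2 (fun hc => Finset.disjoint_left.mp hT.2 hc huI) h.1 h.2
    rw [Finset.sum_eq_single (Bm n d F k e u)]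
    · by_cases g1 : Good n d k (Img e) (Bm n d F k e u)
      · by_cases g2 : PT n d k (Bm n d F k e u) e ⊆ F ∧
          Disjoint (QT n d k (Bm n d F k e u) e u) F
        · rw [if_pos g1, if_pos g2, mul_one]
          unfold Xloc
          rw [if_pos ⟨g1, g2.1⟩]
        · rw [if_neg g2, mul_zero]; exact hnn
      · rw [if_neg g1, zero_mul]; exact hnn
    · intro T _ hT
      by_cases g1 : Good n d k (Img e) T
      · rw [if_neg (fun g2 => hT (hB T g1 g2).symm), mul_zero]
      · rw [if_neg g1, zero_mul]
    · intro h; exact absurd (Finset.mem_univ _) h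
  refine le_trans ?_ h1
  rw [expectY_sum]
  have h2 : 1 - Ex (wt n d p k) (xv n d k) - Pr (wt n d p k) (fun T => ¬ Good n d k (Img e) T) ≤
      Ex (wt n d p k) (fun T => if Good n d k (Img e) T then 1 - xv n d k T else 0) := by
    have e1 := Ex_const hw 1
    calc _ = Ex (wt n d p k) (fun T => 1 - xv n d k T -
          if ¬ Good n d k (Img e) T then 1 else 0) := by
          rw [Ex_sub, Ex_sub, e1]
          unfold Pr
          congr!
      _ ≤ _ := by
          apply Ex_mono hw
          intro T
          by_cases g : Good n d k (Img e) T
          · simp [g]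
          · simp [g, (xv_pos hd k T).le]
  refine h2.trans ?_
  unfold Ex
  refine Finset.sum_le_sum fun T _ => ?_
  by_cases g : Good n d k (Img e) T
  · have hx1 := xv_le_one hd k T
    simp only [g, if_true]
    have e1 : expectY n d p (fun F => (1 - xv n d k T) *
        (if PT n d k T e ⊆ F ∧ Disjoint (QT n d k T e u) F then (1 : ℝ) else 0)) =
        (p ^ (PT n d k T e).card * (1 - p) ^ (QT n d k T e u).card) * (1 - xv n d k T) := by
      rw [← cyl (allFaces n d) (PT n d k T e) (QT n d k T e u) ?_ ?_ ?_ p]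
      · unfold expectY
        rw [Finset.sum_mul]
        refine Finset.sum_congr rfl fun F _ => by ring_nf
      · intro s hs
        simpa [allFaces] using PT_card k T e he g.1 g.2 s hs
      · intro s hs
        simpa [allFaces] using QT_card k T e u he g.1 g.2 s hs
      · rw [Finset.disjoint_left]
        exact PQ_disj k T e u he g.1 g.2
    rw [e1]
    exact mul_le_mul_of_nonneg_right (wt_le hp0 hp1 k T e u) (by linarith)
  · simp [g, expectY]

lemma exists_enum (t : Finset (Fin n)) (ht : t.card = d) :
    ∃ e : Fin d → Fin n, Function.Injective e ∧ Img e = t := by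
  refine ⟨t.orderEmbOfFin ht, (t.orderEmbOfFin ht).injective, ?_⟩
  unfold Img
  exact Finset.image_orderEmbOfFin_univ t ht

lemma main_bound (hd : 0 < d) (k : ℕ) {p : ℝ} (hp0 : 0 ≤ p) (hp1 : p ≤ 1) {b : ℝ}
    (hb : ∀ e : Fin d → Fin n, Pr (wt n d p k) (fun T => ¬ Good n d k (Img e) T) ≤ b) :
    expectY n d p (fun F => (dimKer n F : ℝ)) ≤
      p * n.choose (d + 1) - n.choose d * (1 - Ex (wt n d p k) (xv n d k) - b) := by
  let Z : Finset (Fin n) → Finset (Finset (Fin n)) → ℝ := fun t F =>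
    if h : t.card = d then Xloc hd k (t.orderEmbOfFin h) F else 0
  let D : Finset (Finset (Fin n)) := Finset.powersetCard d Finset.univ
  have hD : ∀ t ∈ D, t.card = d := fun t ht => (Finset.mem_powersetCard.mp ht).2
  have hDc : D.card = n.choose d := by simp [D]
  have h1 : ∀ F, (dimKer n F : ℝ) ≤ F.card - ∑ t ∈ D, Z t F := by
    intro F
    have := dimKer_le F D (fun t => 1 - Z t F) (by
      intro t ht
      have h := hD t ht
      obtain ⟨r, hr1, hr2⟩ := Xloc_res hd k (t.orderEmbOfFin h).injective F
      have hI : Img (t.orderEmbOfFin h) = t := by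
        unfold Img
        exact Finset.image_orderEmbOfFin_univ t h
      rw [hI] at hr1
      refine ⟨r, hr1, ?_⟩
      have hZ : Z t F = Xloc hd k (t.orderEmbOfFin h) F := dif_pos h
      rw [hZ]
      exact hr2)
    simpa using this
  refine (expectY_mono hp0 hp1 h1).trans ?_
  rw [expectY_sub, expectY_card, expectY_sum]
  have h2 : ∀ t ∈ D, 1 - Ex (wt n d p k) (xv n d k) - b ≤ expectY n d p (Z t) := by
    intro t ht
    have h := hD t ht
    have hZ : Z t = Xloc hd k (t.orderEmbOfFin h) := by
      funext F
      exact dif_pos h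
    rw [hZ]
    have h3 := Xloc_exp hd k (t.orderEmbOfFin h).injective hp0 hp1
    have h4 := hb (t.orderEmbOfFin h)
    linarith
  have h3 := Finset.card_nsmul_le_sum D _ _ h2
  rw [hDc, nsmul_eq_mul] at h3
  linarith

end final
end

/-- For `d ≥ 2` and `0 < c < c_d^*`,
`E[dim ker ∂_d(Y_d(n, c/n))] / C(n,d) → 0`, i.e. the expectation is `o(n^d)`. -/
theorem statement5 (d : ℕ) (hd : 2 ≤ d) (c td : ℝ) (hc0 : 0 < c)
    (htd : td ∈ Set.Ioo (0 : ℝ) 1)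
    (hroot : ((d : ℝ) + 1) * (1 - td) + (1 + (d : ℝ) * td) * Real.log td = 0)
    (hc : c < -Real.log td / (1 - td) ^ d) :
    Filter.Tendsto (fun n : ℕ =>
      expectY n d (c / n) (fun F => (dimKer n F : ℝ)) / (n.choose d))
      atTop (nhds 0) := by
  have hd0 : 0 < d := by omega
  have hψ := fun s hs0 => psi_le d hd c td hc0 htd hroot hc s hs0
  rw [Metric.tendsto_atTop]
  intro ε hε
  obtain ⟨K, hK⟩ := A_small d hd0 hc0 hψ (half_pos hε)
  obtain ⟨C, hC0, hC⟩ := notGood_bound d hc0 K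
  obtain ⟨N, hN⟩ := exists_nat_gt (max c (2 * C / ε))
  refine ⟨max N (max d 1), fun n hn => ?_⟩
  have hn1 : N ≤ n := le_trans (le_max_left _ _) hn
  have hnd : d ≤ n := le_trans ((le_max_left _ _).trans (le_max_right _ _)) hn
  have hn0 : 0 < n := by omega
  have hnR : (0 : ℝ) < n := by exact_mod_cast hn0
  have hNn : (N : ℝ) ≤ n := by exact_mod_cast hn1
  have hcn : c ≤ n := ((le_max_left _ _).trans hN.le).trans hNn
  have hCn : C / n < ε / 2 := by
    have h1 : 2 * C / ε < n := ((le_max_right _ _).trans_lt hN).trans_le hNn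
    rw [div_lt_iff₀ hε] at h1
    rw [div_lt_iff₀ hnR]
    linarith
  have hp0 : 0 ≤ c / n := by positivity
  have hp1 : c / n ≤ 1 := by rw [div_le_one hnR]; exact hcn
  have hM := main_bound (n := n) (d := d) hd0 K hp0 hp1 (hC n hn0 hcn)
  have hA := hK n hn0 hcn
  have hch : (0 : ℝ) < n.choose d := by exact_mod_cast Nat.choose_pos hnd
  have hnn : 0 ≤ expectY n d (c / n) (fun F => (dimKer n F : ℝ)) := by
    have h0 := expectY_mono (n := n) (d := d) hp0 hp1 (X := fun _ => 0)
      (Y := fun F => (dimKer n F : ℝ)) (fun F => Nat.cast_nonneg _)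
    simpa [expectY] using h0
  have hbin : c / n * n.choose (d + 1) ≤ n.choose d * (c / (d + 1)) := by
    have h1 : ((n.choose (d + 1) : ℕ) : ℝ) * (d + 1) ≤ n.choose d * n := by
      have h2 : n.choose (d + 1) * (d + 1) ≤ n.choose d * n := by
        rw [Nat.choose_succ_right_eq]
        exact Nat.mul_le_mul_left _ (Nat.sub_le _ _)
      exact_mod_cast h2
    have hd1 : (0 : ℝ) < (d : ℝ) + 1 := by positivity
    rw [div_mul_eq_mul_div, mul_div_assoc', div_le_div_iff₀ hnR hd1]
    nlinarith
  rw [Real.dist_eq, sub_zero, abs_of_nonneg (div_nonneg hnn hch.le), div_lt_iff₀ hch]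
  have h5 : (n.choose d : ℝ) * (c / (d + 1) - ε / 2 - C / n) ≤
      n.choose d * (1 - Ex (wt n d (c / n) K) (xv n d K) - C / n) :=
    mul_le_mul_of_nonneg_left (by linarith) hch.le
  nlinarith

end
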